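/- arXiv:1601.03332 — 2 statements merged into one kernel-verified Lean document; each statement's English description precedes it below -/
import Mathlib

section
/- For every p ∈ [2, ∞) there exists C = C(p) ∈ (0, ∞) such that for every n ∈ ℕ, every k ∈ [n], and every h ∈ L_p^0({−1,1}^n), ( (1/binom(n,k)) Σ_{S ⊆ [n], |S| = k} ‖E_{[n]∖S} h‖_p^p )^{1/p} ≤ C·( (k/n) Σ_{j=1}^n ‖∂_j h‖_p^p + (k/n)^{p/2} ‖h‖_p^p )^{1/p}. -/
open Finset

/-- The normalized `L_p` norm of a function on the discrete hypercube `{-1,1}^n`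
(coordinates encoded by `Bool`). -/
noncomputable def pnorm {n : ℕ} (p : ℝ) (h : (Fin n → Bool) → ℝ) : ℝ :=
  ((∑ ε : Fin n → Bool, |h ε| ^ p) / 2 ^ n) ^ (1 / p)

/-- The hypercube partial derivative `∂_j h (ε) = h(ε) - h(ε with j-th coordinate flipped)`. -/
noncomputable def dflip {n : ℕ} (j : Fin n) (h : (Fin n → Bool) → ℝ) :
    (Fin n → Bool) → ℝ :=
  fun ε => h ε - h (Function.update ε j (!ε j))

/-- `E_S h`: averaging of `h` over the coordinates in `S`. -/
noncomputable def condAvg {n : ℕ} (S : Finset (Fin n)) (h : (Fin n → Bool) → ℝ) :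
    (Fin n → Bool) → ℝ :=
  fun ε => (∑ δ : Fin n → Bool, h (fun j => if j ∈ S then δ j else ε j)) / 2 ^ n

/-! ### Two-point inequalities -/

lemma two_mul_abs_rpow_le {q : ℝ} (hq : 1 ≤ q) (m d : ℝ) :
    2 * |m| ^ q ≤ |m + d| ^ q + |m - d| ^ q := by
  have hconv := (convexOn_rpow hq).2 (Set.mem_Ici.2 (abs_nonneg (m + d)))
    (Set.mem_Ici.2 (abs_nonneg (m - d))) (by norm_num : (0 : ℝ) ≤ 1 / 2)
    (by norm_num : (0 : ℝ) ≤ 1 / 2) (by norm_num)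
  simp only [smul_eq_mul] at hconv
  have hm : |m| ≤ 1 / 2 * |m + d| + 1 / 2 * |m - d| := by
    have := abs_add_le (m + d) (m - d)
    have h2 : |(m + d) + (m - d)| = 2 * |m| := by
      rw [show (m + d) + (m - d) = 2 * m by ring, abs_mul]; norm_num
    linarith
  have := Real.rpow_le_rpow (abs_nonneg m) hm (by linarith : 0 ≤ q)
  linarith

lemma abs_rpow_eq_sq_mul {p : ℝ} (hp : 0 < p) (d : ℝ) : |d| ^ p = d ^ 2 * |d| ^ (p - 2) := by
  rw [← sq_abs d, ← Real.rpow_natCast, ← Real.rpow_add' (abs_nonneg d)]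
  · congr 1; push_cast; ring
  · push_cast; linarith

lemma abs_add_rpow_add_abs_sub_rpow_le {p : ℝ} (hp : 2 ≤ p) {m d : ℝ} (hd : |d| ≤ |m|) :
    |m + d| ^ p + |m - d| ^ p - 2 * |m| ^ p
      ≤ p ^ 2 * Real.exp (p ^ 2 / 2) * (d ^ 2 * |m| ^ (p - 2)) := by
  rcases eq_or_ne m 0 with rfl | hm
  · have : d = 0 := by simpa using hd
    subst this
    have h0 : (0 : ℝ) ^ p = 0 := Real.zero_rpow (by linarith)
    simp [h0]
  obtain ⟨t, rfl⟩ : ∃ t, d = m * t := ⟨d / m, by field_simp⟩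
  have hm' : 0 < |m| := abs_pos.2 hm
  have ht : |t| ≤ 1 := by
    rw [abs_mul] at hd
    exact le_of_mul_le_mul_left (by linarith) hm'
  obtain ⟨ht1, ht2⟩ := abs_le.1 ht
  have key : ∀ s : ℝ, -1 ≤ s → |m + m * s| ^ p ≤ |m| ^ p * Real.exp (p * s) := by
    intro s hs
    rw [show m + m * s = m * (1 + s) by ring, abs_mul,
      Real.mul_rpow (abs_nonneg _) (abs_nonneg _), abs_of_nonneg (by linarith : 0 ≤ 1 + s),
      mul_comm p s, Real.exp_mul]
    gcongr
    · linarith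
    · linarith [Real.add_one_le_exp s]
  have h1 := key t ht1
  have h2 := key (-t) (by linarith)
  rw [show m + m * -t = m - m * t by ring, show p * -t = -(p * t) by ring] at h2
  have h3 := Real.cosh_le_exp_half_sq (p * t)
  rw [Real.cosh_eq] at h3
  set s := (p * t) ^ 2 / 2 with hs
  have hs0 : 0 ≤ s := by positivity
  have htsq : t ^ 2 ≤ 1 := by rw [sq_le_one_iff_abs_le_one]; exact ht
  have hs1 : s ≤ p ^ 2 / 2 := by
    rw [hs, mul_pow]; nlinarith [sq_nonneg p]
  have h4 : Real.exp s ≤ 1 + s * Real.exp (p ^ 2 / 2) := by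
    have h5 : Real.exp s ≤ 1 + s * Real.exp s := by
      have h6 := Real.add_one_le_exp (-s)
      have h7 : Real.exp s * Real.exp (-s) = 1 := by rw [← Real.exp_add]; simp
      nlinarith [Real.exp_pos s]
    have := mul_le_mul_of_nonneg_left (Real.exp_le_exp.2 hs1) hs0
    linarith
  have h8 : 0 ≤ |m| ^ p := by positivity
  have h9 : Real.exp (p * t) + Real.exp (-(p * t)) ≤ 2 + 2 * (s * Real.exp (p ^ 2 / 2)) := by
    linarith
  have h10 := mul_le_mul_of_nonneg_left h9 h8
  have h11 : p ^ 2 * Real.exp (p ^ 2 / 2) * ((m * t) ^ 2 * |m| ^ (p - 2))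
      = |m| ^ p * (2 * (s * Real.exp (p ^ 2 / 2))) := by
    rw [abs_rpow_eq_sq_mul (by linarith : 0 < p) m, hs]; ring
  rw [h11]
  nlinarith

lemma exists_two_point_bound {p : ℝ} (hp : 2 ≤ p) :
    ∃ C : ℝ, 0 < C ∧ ∀ m d a b : ℝ, 0 ≤ a → 0 ≤ b → b ^ 2 = a ^ 2 + d ^ 2 →
      |m + d| ^ p + |m - d| ^ p - 2 * |m| ^ p
        ≤ C * (b ^ p - a ^ p + 2 * ((b - a) * |m| ^ (p - 1))) := by
  refine ⟨2 * 2 ^ p + p ^ 2 * Real.exp (p ^ 2 / 2), by positivity, ?_⟩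
  intro m d a b ha hb hab
  have hab' : a ≤ b := by
    apply le_of_sq_le_sq _ hb; nlinarith [sq_nonneg d]
  have hdb : |d| ≤ b := by
    apply le_of_sq_le_sq _ hb; rw [sq_abs]; nlinarith [sq_nonneg a]
  have hpow : d ^ 2 * b ^ (p - 2) ≤ b ^ p - a ^ p := by
    have e1 := abs_rpow_eq_sq_mul (by linarith : 0 < p) b
    have e2 := abs_rpow_eq_sq_mul (by linarith : 0 < p) a
    rw [abs_of_nonneg hb] at e1
    rw [abs_of_nonneg ha] at e2
    have h1 : a ^ (p - 2) ≤ b ^ (p - 2) := Real.rpow_le_rpow ha hab' (by linarith)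
    have := mul_le_mul_of_nonneg_left h1 (sq_nonneg a)
    rw [e1, e2, hab]
    linarith
  have hX : 0 ≤ d ^ 2 * b ^ (p - 2) := by positivity
  have hY : 0 ≤ (b - a) * |m| ^ (p - 1) :=
    mul_nonneg (by linarith) (by positivity)
  have hE : 0 < p ^ 2 * Real.exp (p ^ 2 / 2) := by positivity
  have h2p : (0 : ℝ) < 2 ^ p := by positivity
  rcases le_or_gt |d| |m| with hdm | hdm
  · refine (abs_add_rpow_add_abs_sub_rpow_le hp hdm).trans ?_
    have h1 : d ^ 2 * |m| ^ (p - 2) ≤ b ^ p - a ^ p + 2 * ((b - a) * |m| ^ (p - 1)) := by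
      rcases le_or_gt |m| b with hmb | hmb
      · have : d ^ 2 * |m| ^ (p - 2) ≤ d ^ 2 * b ^ (p - 2) := by
          gcongr
        linarith
      · have hm0 : 0 < |m| := lt_of_le_of_lt hb hmb
        have e : |m| ^ (p - 1) = |m| * |m| ^ (p - 2) := by
          rw [← Real.rpow_one_add' (abs_nonneg m) (by linarith)]
          congr 1; ring
        have h2 : d ^ 2 ≤ 2 * (b - a) * |m| := by nlinarith
        have h3 : 0 ≤ |m| ^ (p - 2) := by positivity
        have h4 := mul_le_mul_of_nonneg_right h2 h3
        rw [e]
        nlinarith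
    exact mul_le_mul (by linarith) h1 (by positivity) (by positivity)
  · have key : ∀ x : ℝ, |x| ≤ 2 * |d| → |x| ^ p ≤ 2 ^ p * (d ^ 2 * b ^ (p - 2)) := by
      intro x hx
      have h1 := Real.rpow_le_rpow (abs_nonneg x) hx (by linarith : 0 ≤ p)
      rw [Real.mul_rpow (by norm_num) (abs_nonneg d),
        abs_rpow_eq_sq_mul (by linarith : 0 < p) d] at h1
      refine h1.trans ?_
      gcongr
    have h1 := key (m + d) (by linarith [abs_add_le m d])
    have h2 := key (m - d) (by linarith [abs_sub m d])
    have h3 : 0 ≤ |m| ^ p := by positivity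
    have h4 : (0:ℝ) ≤ 2 * 2 ^ p + p ^ 2 * Real.exp (p ^ 2 / 2) := by positivity
    nlinarith [mul_nonneg hE.le (by linarith : 0 ≤ b ^ p - a ^ p + 2 * ((b - a) * |m| ^ (p - 1)))]

lemma exists_mul_rpow_sub_one_le {p : ℝ} (hp : 1 ≤ p) {C : ℝ} (hC : 0 < C) :
    ∃ K : ℝ, 0 < K ∧ ∀ x y : ℝ, 0 ≤ x → 0 ≤ y →
      C * (x * y ^ (p - 1)) ≤ y ^ p / 2 + K * x ^ p := by
  refine ⟨C * (2 * C) ^ (p - 1), by positivity, fun x y hx hy => ?_⟩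
  have e : ∀ z : ℝ, 0 ≤ z → z ^ p = z * z ^ (p - 1) := fun z hz => by
    rw [← Real.rpow_one_add' hz (by linarith)]; congr 1; ring
  have hyp : 0 ≤ y ^ (p - 1) := by positivity
  have hxp : 0 ≤ x ^ p := by positivity
  have hyp' : 0 ≤ y ^ p := by positivity
  rcases le_or_gt (2 * C * x) y with h | h
  · have h1 := mul_le_mul_of_nonneg_right h hyp
    have h2 : 0 ≤ C * (2 * C) ^ (p - 1) * x ^ p := by positivity
    rw [e y hy] at *
    nlinarith
  · have h1 : y ^ (p - 1) ≤ (2 * C * x) ^ (p - 1) :=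
      Real.rpow_le_rpow hy h.le (by linarith)
    rw [Real.mul_rpow (by positivity) hx] at h1
    have h2 := mul_le_mul_of_nonneg_left h1 (mul_nonneg hC.le hx)
    rw [e x hx]
    nlinarith

/-! ### Square functions of conditionally symmetric martingales -/

/-- `M` is a martingale up to time `N` on the finite uniform probability space `Ω` whose `k`-th
increment changes sign under the symmetry `σ k`, and `a` is its square function. -/
structure IsSymmetricMartingale {Ω : Type*} (N : ℕ) (σ : ℕ → Equiv.Perm Ω)
    (M a : ℕ → Ω → ℝ) : Prop where
  nonneg : ∀ k ω, 0 ≤ a k ω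
  zero : ∀ ω, a 0 ω = 0
  sq_succ : ∀ k ω, a (k + 1) ω ^ 2 = a k ω ^ 2 + (M (k + 1) ω - M k ω) ^ 2
  symm_left : ∀ k < N, ∀ ω, M k (σ k ω) = M k ω
  symm_succ : ∀ k < N, ∀ ω, M (k + 1) (σ k ω) = M k ω - (M (k + 1) ω - M k ω)
  symm_sq : ∀ k < N, ∀ ω, a (k + 1) (σ k ω) = a (k + 1) ω

namespace IsSymmetricMartingale

variable {Ω : Type*} {N : ℕ} {σ : ℕ → Equiv.Perm Ω} {M a : ℕ → Ω → ℝ}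

lemma le_succ (h : IsSymmetricMartingale N σ M a) (k : ℕ) (ω : Ω) : a k ω ≤ a (k + 1) ω := by
  apply le_of_sq_le_sq _ (h.nonneg _ _)
  nlinarith [h.sq_succ k ω, sq_nonneg (M (k + 1) ω - M k ω)]

variable [Fintype Ω]

lemma two_mul_sum (h : IsSymmetricMartingale N σ M a) {k : ℕ} (hk : k < N) (F : ℝ → ℝ → ℝ) :
    2 * ∑ ω, F (a (k + 1) ω) (M (k + 1) ω) =
      ∑ ω, (F (a (k + 1) ω) (M k ω + (M (k + 1) ω - M k ω)) +
        F (a (k + 1) ω) (M k ω - (M (k + 1) ω - M k ω))) := by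
  have h1 : ∑ ω, F (a (k + 1) ω) (M (k + 1) ω) =
      ∑ ω, F (a (k + 1) ω) (M k ω - (M (k + 1) ω - M k ω)) := by
    rw [← Equiv.sum_comp (σ k)]
    refine sum_congr rfl fun ω _ => ?_
    rw [h.symm_sq k hk, h.symm_succ k hk]
  rw [sum_add_distrib, ← h1, two_mul]
  simp

lemma sum_sq_rpow_le (h : IsSymmetricMartingale N σ M a) {p : ℝ} (hp : 2 ≤ p) :
    ∀ k ≤ N, ∑ ω, a k ω ^ p ≤ p / 2 * ∑ ω, a k ω ^ (p - 2) * M k ω ^ 2 := by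
  intro k
  induction k with
  | zero =>
    intro _
    have : ∑ ω, a 0 ω ^ p = 0 :=
      sum_eq_zero fun ω _ => by rw [h.zero, Real.zero_rpow (by linarith)]
    rw [this]
    have := fun ω => h.nonneg 0 ω
    exact mul_nonneg (by linarith) (sum_nonneg fun ω _ =>
      mul_nonneg (Real.rpow_nonneg (this ω) _) (sq_nonneg _))
  | succ k ih =>
    intro hk
    have ih := ih (by omega)
    have e := h.two_mul_sum (k := k) (by omega) (fun a m => a ^ (p - 2) * m ^ 2)
    have h1 : ∑ ω, (a (k + 1) ω ^ p - a k ω ^ p) ≤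
        p / 2 * ∑ ω, (a (k + 1) ω ^ (p - 2) * (M (k + 1) ω - M k ω) ^ 2) := by
      rw [mul_sum]
      refine sum_le_sum fun ω _ => ?_
      set b := a (k + 1) ω
      set c := a k ω
      have hb : 0 ≤ b := h.nonneg _ _
      have hc : 0 ≤ c := h.nonneg _ _
      have hcb : c ≤ b := h.le_succ _ _
      have hd : b ^ 2 - c ^ 2 = (M (k + 1) ω - M k ω) ^ 2 := by
        have := h.sq_succ k ω
        linarith
      rw [← hd]
      have hr : 1 ≤ p / 2 := by linarith
      have pw : ∀ x : ℝ, 0 ≤ x → x ^ p = (x ^ 2) ^ (p / 2) := fun x hx => by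
        rw [← Real.rpow_natCast, ← Real.rpow_mul hx]; congr 1; push_cast; ring
      have pw2 : b ^ (p - 2) = (b ^ 2) ^ (p / 2 - 1) := by
        rw [← Real.rpow_natCast, ← Real.rpow_mul hb]; congr 1; push_cast; ring
      rw [pw b hb, pw c hc, pw2]
      rcases eq_or_lt_of_le (sq_nonneg b) with hb0 | hb0
      · have : c ^ 2 = 0 := le_antisymm (by rw [hb0]; gcongr) (sq_nonneg c)
        rw [this, ← hb0]; simp
      · have hbern := one_add_mul_self_le_rpow_one_add
          (s := c ^ 2 / b ^ 2 - 1) (by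
            have : 0 ≤ c ^ 2 / b ^ 2 := by positivity
            linarith) hr
        rw [show 1 + (c ^ 2 / b ^ 2 - 1) = c ^ 2 / b ^ 2 by ring,
          Real.div_rpow (sq_nonneg c) (sq_nonneg b), le_div_iff₀ (by positivity)] at hbern
        have e2 : (b ^ 2) ^ (p / 2) = b ^ 2 * (b ^ 2) ^ (p / 2 - 1) := by
          rw [← Real.rpow_one_add' (sq_nonneg b) (by linarith)]; congr 1; ring
        have e3 : (1 + p / 2 * (c ^ 2 / b ^ 2 - 1)) * (b ^ 2) ^ (p / 2) =
            (b ^ 2) ^ (p / 2) - p / 2 * ((b ^ 2) ^ (p / 2 - 1) * (b ^ 2 - c ^ 2)) := by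
          rw [e2]
          linear_combination p / 2 * (b ^ 2) ^ (p / 2 - 1) * div_mul_cancel₀ (c ^ 2) hb0.ne'
        linarith
    have h2 : ∑ ω, a (k + 1) ω ^ (p - 2) * (M (k + 1) ω - M k ω) ^ 2 ≤
        ∑ ω, a (k + 1) ω ^ (p - 2) * M (k + 1) ω ^ 2 - ∑ ω, a k ω ^ (p - 2) * M k ω ^ 2 := by
      have e' : 2 * ∑ ω, a (k + 1) ω ^ (p - 2) * M (k + 1) ω ^ 2 =
          2 * ∑ ω, (a (k + 1) ω ^ (p - 2) * M k ω ^ 2 +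
            a (k + 1) ω ^ (p - 2) * (M (k + 1) ω - M k ω) ^ 2) := by
        rw [e, mul_sum]
        exact sum_congr rfl fun ω _ => by ring
      rw [sum_add_distrib] at e'
      have : ∑ ω, a k ω ^ (p - 2) * M k ω ^ 2 ≤ ∑ ω, a (k + 1) ω ^ (p - 2) * M k ω ^ 2 :=
        sum_le_sum fun ω _ => mul_le_mul_of_nonneg_right
          (Real.rpow_le_rpow (h.nonneg _ _) (h.le_succ _ _) (by linarith)) (sq_nonneg _)
      linarith
    rw [sum_sub_distrib] at h1
    have h3 := mul_le_mul_of_nonneg_left h2 (by linarith : 0 ≤ p / 2)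
    linarith

lemma sum_abs_rpow_le (h : IsSymmetricMartingale N σ M a) (h0 : ∀ ω, M 0 ω = 0)
    {p C : ℝ} (hp : 2 ≤ p) (hC : 0 < C)
    (hbound : ∀ m d a b : ℝ, 0 ≤ a → 0 ≤ b → b ^ 2 = a ^ 2 + d ^ 2 →
      |m + d| ^ p + |m - d| ^ p - 2 * |m| ^ p
        ≤ C * (b ^ p - a ^ p + 2 * ((b - a) * |m| ^ (p - 1)))) :
    ∀ k ≤ N, 2 * ∑ ω, |M k ω| ^ p ≤
      C * (∑ ω, a k ω ^ p + 2 * ∑ ω, a k ω * |M k ω| ^ (p - 1)) := by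
  intro k
  induction k with
  | zero =>
    intro _
    have h1 : (0 : ℝ) ^ p = 0 := Real.zero_rpow (by linarith)
    simp [h0, h.zero, h1]
  | succ k ih =>
    intro hk
    have ih := ih (by omega)
    have e1 := h.two_mul_sum (k := k) (by omega) (fun _ m => |m| ^ p)
    have e2 := h.two_mul_sum (k := k) (by omega) (fun a m => a * |m| ^ (p - 1))
    have h1 := sum_le_sum fun ω (_ : ω ∈ univ) => hbound (M k ω) (M (k + 1) ω - M k ω)
      (a k ω) (a (k + 1) ω) (h.nonneg _ _) (h.nonneg _ _) (h.sq_succ _ _)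
    rw [← mul_sum, sum_sub_distrib, ← e1, ← mul_sum, sum_add_distrib, sum_sub_distrib,
      ← mul_sum] at h1
    have h2 : ∑ ω, (a (k + 1) ω - a k ω) * |M k ω| ^ (p - 1) ≤
        ∑ ω, a (k + 1) ω * |M (k + 1) ω| ^ (p - 1) - ∑ ω, a k ω * |M k ω| ^ (p - 1) := by
      have : 2 * ∑ ω, a (k + 1) ω * |M k ω| ^ (p - 1) ≤
          2 * ∑ ω, a (k + 1) ω * |M (k + 1) ω| ^ (p - 1) := by
        rw [e2, mul_sum]
        refine sum_le_sum fun ω _ => ?_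
        have := mul_le_mul_of_nonneg_left
          (two_mul_abs_rpow_le (by linarith : 1 ≤ p - 1) (M k ω) (M (k + 1) ω - M k ω))
          (h.nonneg (k + 1) ω)
        linarith
      simp only [sub_mul, sum_sub_distrib]
      linarith
    have h3 := mul_le_mul_of_nonneg_left h2 hC.le
    nlinarith

end IsSymmetricMartingale

lemma exists_square_function_upper {p : ℝ} (hp : 2 ≤ p) :
    ∃ C : ℝ, 0 < C ∧ ∀ (Ω : Type) [Fintype Ω] (N : ℕ) (σ : ℕ → Equiv.Perm Ω)
      (M a : ℕ → Ω → ℝ), IsSymmetricMartingale N σ M a →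
      ∑ ω, a N ω ^ p ≤ C * ∑ ω, |M N ω| ^ p := by
  obtain ⟨K, hK, hK'⟩ := exists_mul_rpow_sub_one_le (p := p / 2) (by linarith)
    (C := p / 2) (by linarith)
  refine ⟨2 * K, by positivity, fun Ω _ N σ M a h => ?_⟩
  have h1 := h.sum_sq_rpow_le hp N le_rfl
  have h2 : p / 2 * ∑ ω, a N ω ^ (p - 2) * M N ω ^ 2 ≤
      ∑ ω, (a N ω ^ p / 2 + K * |M N ω| ^ p) := by
    rw [mul_sum]
    refine sum_le_sum fun ω _ => ?_
    have ha := h.nonneg N ω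
    have h3 := hK' (M N ω ^ 2) (a N ω ^ 2) (sq_nonneg _) (sq_nonneg _)
    rw [← sq_abs (M N ω)] at h3 ⊢
    rw [← Real.rpow_natCast (a N ω), ← Real.rpow_natCast |M N ω|, ← Real.rpow_mul ha,
      ← Real.rpow_mul ha, ← Real.rpow_mul (abs_nonneg _)] at h3
    rw [← Real.rpow_natCast |M N ω|]
    push_cast at h3 ⊢
    rw [show (2 : ℝ) * (p / 2 - 1) = p - 2 by ring, show (2 : ℝ) * (p / 2) = p by ring] at h3
    linarith
  rw [sum_add_distrib, ← mul_sum, ← sum_div] at h2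
  linarith

lemma exists_square_function_lower {p : ℝ} (hp : 2 ≤ p) :
    ∃ C : ℝ, 0 < C ∧ ∀ (Ω : Type) [Fintype Ω] (N : ℕ) (σ : ℕ → Equiv.Perm Ω)
      (M a : ℕ → Ω → ℝ), IsSymmetricMartingale N σ M a → (∀ ω, M 0 ω = 0) →
      ∑ ω, |M N ω| ^ p ≤ C * ∑ ω, a N ω ^ p := by
  obtain ⟨C, hC, hbound⟩ := exists_two_point_bound hp
  obtain ⟨K, hK, hK'⟩ := exists_mul_rpow_sub_one_le (p := p) (by linarith) (C := 2 * C)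
    (by positivity)
  refine ⟨C + K, by positivity, fun Ω _ N σ M a h h0 => ?_⟩
  have h1 := h.sum_abs_rpow_le h0 hp hC hbound N le_rfl
  have h2 : 2 * C * ∑ ω, a N ω * |M N ω| ^ (p - 1) ≤
      ∑ ω, (|M N ω| ^ p / 2 + K * a N ω ^ p) := by
    rw [mul_sum]
    exact sum_le_sum fun ω _ => hK' _ _ (h.nonneg _ _) (abs_nonneg _)
  rw [sum_add_distrib, ← mul_sum, ← sum_div] at h2
  have h3 : 0 ≤ ∑ ω, |M N ω| ^ p := sum_nonneg fun ω _ => by positivity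
  nlinarith

/-! ### Averages over random subsets -/

lemma sum_powersetCard_sum_erase {n : ℕ} (k : ℕ) (F : Finset (Fin n) → Fin n → ℝ) :
    ∑ S ∈ powersetCard (k + 1) (univ : Finset (Fin n)), ∑ i ∈ S, F (S.erase i) i =
      ∑ T ∈ powersetCard k (univ : Finset (Fin n)), ∑ i ∈ Tᶜ, F T i := by
  rw [sum_sigma', sum_sigma']
  refine sum_bij' (fun x _ => ⟨x.1.erase x.2, x.2⟩) (fun x _ => ⟨insert x.2 x.1, x.2⟩) ?_ ?_ ?_ ?_ ?_
  · rintro ⟨S, i⟩ h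
    simp only [mem_sigma, mem_powersetCard, subset_univ, true_and, mem_compl] at h ⊢
    simp [card_erase_of_mem h.2, h.1]
  · rintro ⟨S, i⟩ h
    simp only [mem_sigma, mem_powersetCard, subset_univ, true_and, mem_compl] at h ⊢
    simp [card_insert_of_notMem h.2, h.1]
  · rintro ⟨S, i⟩ h
    simp only [mem_sigma, mem_powersetCard, subset_univ, true_and] at h
    simp [insert_erase h.2]
  · rintro ⟨S, i⟩ h
    simp only [mem_sigma, mem_powersetCard, subset_univ, true_and, mem_compl] at h
    simp [erase_insert h.2]
  · rintro ⟨S, i⟩ h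
    rfl

lemma add_rpow_le_two_rpow_mul {s : ℝ} (hs : 0 ≤ s) {x y : ℝ} (hx : 0 ≤ x) (hy : 0 ≤ y) :
    (x + y) ^ s ≤ 2 ^ s * (x ^ s + y ^ s) := by
  have hx' : 0 ≤ x ^ s := by positivity
  have hy' : 0 ≤ y ^ s := by positivity
  have h2 : (0 : ℝ) < 2 ^ s := by positivity
  rcases le_total x y with h | h
  · have := Real.rpow_le_rpow (by positivity) (by linarith : x + y ≤ 2 * y) hs
    rw [Real.mul_rpow (by norm_num) hy] at this
    nlinarith
  · have := Real.rpow_le_rpow (by positivity) (by linarith : x + y ≤ 2 * x) hs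
    rw [Real.mul_rpow (by norm_num) hx] at this
    nlinarith

lemma sum_rpow_le_sum_mul_add {ι : Type*} [DecidableEq ι] {r : ℝ} (hr : 1 ≤ r) (S : Finset ι)
    {b : ι → ℝ} (hb : ∀ i, 0 ≤ b i) :
    (∑ i ∈ S, b i) ^ r ≤
      2 ^ (r - 1) * ∑ i ∈ S, (b i ^ r + b i * (∑ j ∈ S.erase i, b j) ^ (r - 1)) := by
  have hX : 0 ≤ ∑ i ∈ S, b i := sum_nonneg fun i _ => hb i
  have e : ∀ z : ℝ, 0 ≤ z → z ^ r = z * z ^ (r - 1) := fun z hz => by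
    rw [← Real.rpow_one_add' hz (by linarith)]; congr 1; ring
  rw [e _ hX, sum_mul, mul_sum]
  refine sum_le_sum fun i hi => ?_
  rw [← add_sum_erase S b hi, e _ (hb i)]
  have := mul_le_mul_of_nonneg_left (add_rpow_le_two_rpow_mul (by linarith : 0 ≤ r - 1) (hb i)
    (sum_nonneg fun j (_ : j ∈ S.erase i) => hb j)) (hb i)
  linarith

lemma exists_sum_powersetCard_rpow_le {r : ℝ} (hr : 1 ≤ r) :
    ∃ C : ℝ, 0 < C ∧ ∀ n k : ℕ, 1 ≤ k → k ≤ n → ∀ b : Fin n → ℝ, (∀ i, 0 ≤ b i) →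
      ∑ S ∈ powersetCard k (univ : Finset (Fin n)), (∑ i ∈ S, b i) ^ r ≤
        n.choose k * (C * ((k : ℝ) / n * ∑ i, b i ^ r + ((k : ℝ) / n) ^ r * (∑ i, b i) ^ r)) := by
  obtain ⟨K, hK, hK'⟩ := exists_mul_rpow_sub_one_le hr (C := 2 ^ (r - 1)) (by positivity)
  refine ⟨2 ^ r + 4 * 2 ^ (r - 1) + 2 * K * 2 ^ r, by positivity, fun n k hk hkn b hb => ?_⟩
  have hB : 0 ≤ ∑ i, b i := sum_nonneg fun i _ => hb i
  have hBr : 0 ≤ ∑ i, b i ^ r := sum_nonneg fun i _ => Real.rpow_nonneg (hb i) _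
  have hn0 : (0 : ℝ) < n := by exact_mod_cast (by omega : 0 < n)
  have hk0 : (0 : ℝ) < k := by exact_mod_cast (by omega : 0 < k)
  have hle : ∀ S : Finset (Fin n), ∑ i ∈ S, b i ≤ ∑ i, b i := fun S =>
    sum_le_sum_of_subset_of_nonneg (subset_univ _) fun i _ _ => hb i
  have hcard : ∀ x : ℝ, ∑ _S ∈ powersetCard k (univ : Finset (Fin n)), x = n.choose k * x := by
    intro x; simp
  have h2r : (0 : ℝ) < 2 ^ r := by positivity
  have h2r1 : (0 : ℝ) < 2 ^ (r - 1) := by positivity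
  have hU : 0 ≤ (k : ℝ) / n * ∑ i, b i ^ r := by positivity
  have hV : 0 ≤ ((k : ℝ) / n) ^ r * (∑ i, b i) ^ r := by positivity
  rcases le_or_gt n (2 * k) with h | h
  · rw [← hcard]
    refine sum_le_sum fun S _ => ?_
    have h' : (n : ℝ) ≤ 2 * k := by exact_mod_cast h
    have h1 : (1 : ℝ) ≤ 2 * (k / n) := by
      rw [← mul_div_assoc, le_div_iff₀ hn0]; linarith
    have h2 : ∑ i ∈ S, b i ≤ 2 * (k / n) * ∑ i, b i := by nlinarith [hle S]
    have h3 := Real.rpow_le_rpow (sum_nonneg fun i _ => hb i) h2 (by linarith : 0 ≤ r)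
    rw [mul_assoc, Real.mul_rpow (by norm_num) (by positivity),
      Real.mul_rpow (by positivity) hB] at h3
    refine h3.trans ?_
    have : 0 ≤ 4 * 2 ^ (r - 1) + 2 * K * 2 ^ r := by positivity
    nlinarith [mul_nonneg this (add_nonneg hU hV), mul_nonneg h2r.le hU]
  · obtain ⟨l, rfl⟩ : ∃ l, k = l + 1 := ⟨k - 1, by omega⟩
    have hch : ((n.choose l : ℕ) : ℝ) * (n - l) = n.choose (l + 1) * ((l + 1 : ℕ) : ℝ) := by
      have := Nat.choose_succ_right_eq n l
      rw [← Nat.cast_sub (by omega)]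
      exact_mod_cast this.symm
    have hnl : (n : ℝ) ≤ 2 * (n - l) := by
      have : (2 * (l + 1) : ℝ) < n := by exact_mod_cast h
      linarith
    set κ : ℝ := ((l + 1 : ℕ) : ℝ) / n with hκ
    have hκ0 : 0 ≤ κ := by positivity
    set N : ℝ := (n.choose (l + 1) : ℝ) with hN
    have hN0 : 0 ≤ N := by positivity
    have hN' : (n.choose l : ℝ) ≤ N * (2 * κ) := by
      have h1 : N * (2 * κ) = 2 * (N * ((l + 1 : ℕ) : ℝ)) / n := by rw [hκ]; ring
      rw [h1, le_div_iff₀ hn0, ← hch]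
      have : (0 : ℝ) ≤ n.choose l := by positivity
      nlinarith
    set Φ : Finset (Fin n) → ℝ := fun T => (∑ i ∈ T, b i) ^ (r - 1) with hΦ
    have hΦ0 : ∀ T, 0 ≤ Φ T := fun T => Real.rpow_nonneg (sum_nonneg fun i _ => hb i) _
    set X := ∑ S ∈ powersetCard (l + 1) (univ : Finset (Fin n)), (∑ i ∈ S, b i) ^ r with hX
    have h1 : X ≤ 2 ^ (r - 1) * ∑ T ∈ powersetCard l (univ : Finset (Fin n)),
        ∑ i ∈ Tᶜ, (b i ^ r + b i * Φ T) := by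
      rw [← sum_powersetCard_sum_erase l (fun T i => b i ^ r + b i * Φ T), mul_sum]
      exact sum_le_sum fun S _ => sum_rpow_le_sum_mul_add hr S hb
    have h2 : ∑ T ∈ powersetCard l (univ : Finset (Fin n)), ∑ i ∈ Tᶜ, (b i ^ r + b i * Φ T) ≤
        (n.choose l : ℝ) * (∑ i, b i ^ r) +
          (∑ i, b i) * ∑ T ∈ powersetCard l (univ : Finset (Fin n)), Φ T := by
      have : ∑ T ∈ powersetCard l (univ : Finset (Fin n)), ((∑ i, b i ^ r) + (∑ i, b i) * Φ T) =
          (n.choose l : ℝ) * (∑ i, b i ^ r) +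
          (∑ i, b i) * ∑ T ∈ powersetCard l (univ : Finset (Fin n)), Φ T := by
        rw [sum_add_distrib, ← mul_sum, sum_const, card_powersetCard, card_univ, Fintype.card_fin,
          nsmul_eq_mul]
      rw [← this]
      refine sum_le_sum fun T _ => ?_
      rw [sum_add_distrib, ← sum_mul]
      refine add_le_add ?_ (mul_le_mul_of_nonneg_right (hle _) (hΦ0 T))
      exact sum_le_sum_of_subset_of_nonneg (subset_univ _) fun i _ _ => Real.rpow_nonneg (hb i) _
    have h3 : ∑ T ∈ powersetCard l (univ : Finset (Fin n)), Φ T ≤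
        2 * κ * ∑ S ∈ powersetCard (l + 1) (univ : Finset (Fin n)), Φ S := by
      have e1 := sum_powersetCard_sum_erase (n := n) l (fun T _ => Φ T)
      have e2 : ∑ T ∈ powersetCard l (univ : Finset (Fin n)), ∑ _i ∈ Tᶜ, Φ T =
          ((n : ℝ) - l) * ∑ T ∈ powersetCard l (univ : Finset (Fin n)), Φ T := by
        rw [mul_sum]
        refine sum_congr rfl fun T hT => ?_
        rw [sum_const, card_compl, Fintype.card_fin, (mem_powersetCard.1 hT).2, nsmul_eq_mul,
          Nat.cast_sub (by omega)]
      have e3 : ∑ S ∈ powersetCard (l + 1) (univ : Finset (Fin n)), ∑ i ∈ S, Φ (S.erase i) ≤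
          ((l + 1 : ℕ) : ℝ) * ∑ S ∈ powersetCard (l + 1) (univ : Finset (Fin n)), Φ S := by
        rw [mul_sum]
        refine sum_le_sum fun S hS => ?_
        have : ∑ i ∈ S, Φ (S.erase i) ≤ ∑ _i ∈ S, Φ S :=
          sum_le_sum fun i _ => Real.rpow_le_rpow (sum_nonneg fun j _ => hb j)
            (sum_le_sum_of_subset_of_nonneg (erase_subset _ _) fun j _ _ => hb j) (by linarith)
        rwa [sum_const, (mem_powersetCard.1 hS).2, nsmul_eq_mul] at this
      have hQ : 0 ≤ ∑ T ∈ powersetCard l (univ : Finset (Fin n)), Φ T :=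
        sum_nonneg fun T _ => hΦ0 T
      rw [hκ, show 2 * (((l + 1 : ℕ) : ℝ) / n) *
        ∑ S ∈ powersetCard (l + 1) (univ : Finset (Fin n)), Φ S = 2 * (((l + 1 : ℕ) : ℝ) *
        ∑ S ∈ powersetCard (l + 1) (univ : Finset (Fin n)), Φ S) / n by ring,
        le_div_iff₀ hn0]
      nlinarith
    have h4 : 2 ^ (r - 1) * ((2 * κ * ∑ i, b i) *
        ∑ S ∈ powersetCard (l + 1) (univ : Finset (Fin n)), Φ S) ≤
        X / 2 + N * (K * (2 * κ * ∑ i, b i) ^ r) := by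
      rw [← hcard, hX, sum_div, ← sum_add_distrib, mul_sum, mul_sum]
      exact sum_le_sum fun S _ => hK' _ _ (by positivity) (sum_nonneg fun i _ => hb i)
    rw [mul_assoc 2 κ, Real.mul_rpow (by norm_num) (by positivity),
      Real.mul_rpow hκ0 hB] at h4
    have h5 := mul_le_mul_of_nonneg_left h3 hB
    have h6 := mul_le_mul_of_nonneg_right hN' hBr
    have h7 := mul_le_mul_of_nonneg_left (add_le_add h6 h5) h2r1.le
    have h8 := mul_le_mul_of_nonneg_left h2 h2r1.le
    have h9 : X / 2 ≤ N * (2 * 2 ^ (r - 1) * (κ * ∑ i, b i ^ r) +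
        K * 2 ^ r * (κ ^ r * (∑ i, b i) ^ r)) := by
      linarith
    have h10 : X ≤ N * (4 * 2 ^ (r - 1) * (κ * ∑ i, b i ^ r) +
        2 * K * 2 ^ r * (κ ^ r * (∑ i, b i) ^ r)) := by
      linarith
    refine h10.trans (mul_le_mul_of_nonneg_left ?_ hN0)
    have hK2 : 0 ≤ 2 * K * 2 ^ r := by positivity
    nlinarith [mul_nonneg hK2 hU, mul_nonneg h2r.le hU, mul_nonneg h2r.le hV,
      mul_nonneg h2r1.le hV]

/-! ### Averaging operators on the cube -/

section Cube

variable {n : ℕ}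

lemma condAvg_sub (S : Finset (Fin n)) (g h : (Fin n → Bool) → ℝ) :
    condAvg S (g - h) = condAvg S g - condAvg S h := by
  ext ε
  simp [condAvg, sum_sub_distrib, sub_div]

lemma condAvg_finset_sum {ι : Type*} (S : Finset (Fin n)) (s : Finset ι)
    (f : ι → (Fin n → Bool) → ℝ) (ε : Fin n → Bool) :
    condAvg S (fun ω => ∑ i ∈ s, f i ω) ε = ∑ i ∈ s, condAvg S (f i) ε := by
  simp only [condAvg]
  rw [sum_comm, sum_div]

/-- Exchanging the coordinates in `S` between two points of the cube. -/
def cubeExchange (S : Finset (Fin n)) :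
    Equiv.Perm ((Fin n → Bool) × (Fin n → Bool)) :=
  Function.Involutive.toPerm
    (fun x => (fun j => if j ∈ S then x.2 j else x.1 j, fun j => if j ∈ S then x.1 j else x.2 j))
    (fun x => by ext j <;> by_cases hj : j ∈ S <;> simp [hj])

lemma sum_condAvg (S : Finset (Fin n)) (h : (Fin n → Bool) → ℝ) :
    ∑ ε, condAvg S h ε = ∑ ε, h ε := by
  have h1 : ∑ ε : Fin n → Bool, ∑ δ : Fin n → Bool, h (fun j => if j ∈ S then δ j else ε j) =
      ∑ ε : Fin n → Bool, ∑ _δ : Fin n → Bool, h ε := by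
    rw [← Fintype.sum_prod_type', ← Fintype.sum_prod_type']
    exact Equiv.sum_comp (cubeExchange S) (fun x => h x.1)
  simp only [condAvg]
  rw [← sum_div, h1]
  simp only [sum_const, card_univ, Fintype.card_pi, Fintype.card_bool, prod_const,
    Fintype.card_fin, nsmul_eq_mul, ← mul_sum]
  push_cast
  field_simp

lemma condAvg_condAvg (S T : Finset (Fin n)) (h : (Fin n → Bool) → ℝ) :
    condAvg S (condAvg T h) = condAvg (S ∪ T) h := by
  ext ε
  have h1 := sum_condAvg T (fun δ => h (fun j => if j ∈ S ∪ T then δ j else ε j))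
  simp only [condAvg] at h1 ⊢
  rw [← h1]
  congr 1
  refine sum_congr rfl fun δ _ => ?_
  congr 1
  refine sum_congr rfl fun δ' _ => ?_
  congr 1
  ext j
  by_cases hS : j ∈ S <;> by_cases hT : j ∈ T <;> simp [hS, hT]

lemma abs_condAvg_rpow_le {r : ℝ} (hr : 1 ≤ r) (S : Finset (Fin n)) (h : (Fin n → Bool) → ℝ)
    (ε : Fin n → Bool) : |condAvg S h ε| ^ r ≤ condAvg S (fun ω => |h ω| ^ r) ε := by
  simp only [condAvg]
  set g : (Fin n → Bool) → ℝ := fun δ => h (fun j => if j ∈ S then δ j else ε j)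
  have h1 : |(∑ δ, g δ) / 2 ^ n| ≤ ∑ δ, (1 / 2 ^ n : ℝ) * |g δ| := by
    rw [← mul_sum, abs_div, abs_of_pos (by positivity : (0 : ℝ) < 2 ^ n), one_div_mul_eq_div]
    gcongr
    exact abs_sum_le_sum_abs _ _
  have hw : ∑ _δ : Fin n → Bool, (1 / 2 ^ n : ℝ) = 1 := by simp
  have h2 := Real.rpow_arith_mean_le_arith_mean_rpow univ (fun _ => (1 / 2 ^ n : ℝ))
    (fun δ => |g δ|) (fun _ _ => by positivity) hw (fun _ _ => abs_nonneg _) hr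
  have h3 := Real.rpow_le_rpow (abs_nonneg _) h1 (by linarith : 0 ≤ r)
  refine (h3.trans h2).trans_eq ?_
  rw [← mul_sum, one_div_mul_eq_div]

lemma sum_abs_condAvg_rpow_le {r : ℝ} (hr : 1 ≤ r) (S : Finset (Fin n))
    (h : (Fin n → Bool) → ℝ) : ∑ ε, |condAvg S h ε| ^ r ≤ ∑ ε, |h ε| ^ r :=
  (sum_le_sum fun ε _ => abs_condAvg_rpow_le hr S h ε).trans_eq (sum_condAvg S _)

lemma condAvg_empty (h : (Fin n → Bool) → ℝ) : condAvg ∅ h = h := by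
  ext ε
  simp [condAvg]

lemma condAvg_univ (h : (Fin n → Bool) → ℝ) (ε : Fin n → Bool) :
    condAvg univ h ε = (∑ δ, h δ) / 2 ^ n := by
  simp [condAvg]

/-- Flipping the `j`-th coordinate of a point of the cube. -/
def cubeFlip (j : Fin n) : Equiv.Perm (Fin n → Bool) :=
  Function.Involutive.toPerm (fun ε => Function.update ε j (!ε j)) (fun ε => by simp)

lemma cubeFlip_apply (j : Fin n) (ε : Fin n → Bool) :
    cubeFlip j ε = Function.update ε j (!ε j) := rfl

lemma condAvg_cubeFlip {S : Finset (Fin n)} {j : Fin n} (hj : j ∈ S) (h : (Fin n → Bool) → ℝ)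
    (ε : Fin n → Bool) : condAvg S h (cubeFlip j ε) = condAvg S h ε := by
  simp only [condAvg, cubeFlip_apply]
  congr 1
  refine sum_congr rfl fun δ _ => ?_
  congr 1
  ext i
  by_cases hi : i ∈ S
  · simp [hi]
  · have : i ≠ j := fun e => hi (e ▸ hj)
    simp [hi, this]

lemma condAvg_singleton (j : Fin n) (h : (Fin n → Bool) → ℝ) (ε : Fin n → Bool) :
    condAvg {j} h ε = (h ε + h (cubeFlip j ε)) / 2 := by
  set F : Bool → ℝ := fun b => h (Function.update ε j b) with hF
  have h1 : condAvg {j} h ε = (∑ δ : Fin n → Bool, F (δ j)) / 2 ^ n := by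
    simp only [condAvg, hF]
    congr 1
    refine sum_congr rfl fun δ _ => ?_
    congr 1
    ext i
    by_cases hi : i = j
    · subst hi; simp
    · simp [hi]
  have h2 : ∑ δ : Fin n → Bool, F (!δ j) = ∑ δ : Fin n → Bool, F (δ j) := by
    rw [← Equiv.sum_comp (cubeFlip j) (fun δ => F (δ j))]
    simp [cubeFlip_apply]
  have h3 : ∑ δ : Fin n → Bool, (F (δ j) + F (!δ j)) = 2 ^ n * (h ε + h (cubeFlip j ε)) := by
    have : ∀ δ : Fin n → Bool, F (δ j) + F (!δ j) = h ε + h (cubeFlip j ε) := by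
      intro δ
      have e1 : h ε = F (ε j) := by simp [hF]
      have e2 : h (cubeFlip j ε) = F (!ε j) := rfl
      rw [e1, e2]
      cases δ j <;> cases ε j <;> simp [add_comm]
    simp [this, mul_add]
  rw [sum_add_distrib, h2] at h3
  rw [h1]
  field_simp
  linarith

/-- The coordinates with index at least `k`. -/
def tailCoords (n k : ℕ) : Finset (Fin n) := univ.filter fun j => k ≤ j.val

lemma mem_tailCoords {k : ℕ} {j : Fin n} : j ∈ tailCoords n k ↔ k ≤ j.val := by
  simp [tailCoords]

lemma singleton_union_tailCoords (j : Fin n) :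
    {j} ∪ tailCoords n (j.val + 1) = tailCoords n j.val := by
  ext i
  simp only [mem_union, mem_singleton, mem_tailCoords, Fin.ext_iff]
  omega

/-- The increment, at step `k`, of the martingale which reveals the coordinates in order. -/
noncomputable def revealDiff (k : ℕ) (h : (Fin n → Bool) → ℝ) : (Fin n → Bool) → ℝ :=
  condAvg (tailCoords n (k + 1)) h - condAvg (tailCoords n k) h

lemma condAvg_tailCoords (j : Fin n) (h : (Fin n → Bool) → ℝ) (ε : Fin n → Bool) :
    condAvg (tailCoords n j.val) h ε =
      (condAvg (tailCoords n (j.val + 1)) h ε +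
        condAvg (tailCoords n (j.val + 1)) h (cubeFlip j ε)) / 2 := by
  rw [← singleton_union_tailCoords, ← condAvg_condAvg, condAvg_singleton]

lemma revealDiff_eq_condAvg_dflip (j : Fin n) (h : (Fin n → Bool) → ℝ) :
    revealDiff j.val h = condAvg (tailCoords n (j.val + 1)) (fun ε => dflip j h ε / 2) := by
  rw [revealDiff, ← singleton_union_tailCoords, union_comm, ← condAvg_condAvg, ← condAvg_sub]
  congr 1
  ext ε
  simp only [Pi.sub_apply, condAvg_singleton, dflip, cubeFlip_apply]
  ring

lemma revealDiff_condAvg (S : Finset (Fin n)) (j : Fin n)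
    (h : (Fin n → Bool) → ℝ) :
    revealDiff j.val (condAvg S h) = condAvg S (revealDiff j.val h) := by
  simp only [revealDiff, condAvg_sub, condAvg_condAvg, union_comm S]

lemma revealDiff_condAvg_of_mem {S : Finset (Fin n)} {j : Fin n} (hj : j ∈ S)
    (h : (Fin n → Bool) → ℝ) : revealDiff j.val (condAvg S h) = 0 := by
  have : tailCoords n j.val ∪ S = tailCoords n (j.val + 1) ∪ S := by
    rw [← singleton_union_tailCoords]
    ext i
    simp only [mem_union, mem_singleton]
    constructor
    · rintro ((rfl | h) | h) <;> simp [*]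
    · rintro (h | h) <;> simp [h]
  simp only [revealDiff, condAvg_condAvg, this, sub_self]

lemma revealDiff_cubeFlip_sq {k : ℕ} {j : Fin n} (hk : k ≤ j.val) (h : (Fin n → Bool) → ℝ)
    (ε : Fin n → Bool) : revealDiff k h (cubeFlip j ε) ^ 2 = revealDiff k h ε ^ 2 := by
  rcases hk.lt_or_eq with hk | rfl
  · simp only [revealDiff, Pi.sub_apply]
    rw [condAvg_cubeFlip (mem_tailCoords.2 hk.le), condAvg_cubeFlip (mem_tailCoords.2 hk)]
  · simp only [revealDiff, Pi.sub_apply]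
    rw [condAvg_cubeFlip (mem_tailCoords.2 le_rfl), condAvg_tailCoords]
    ring

/-- The symmetry of the cube used at step `k` of the coordinate-revealing martingale. -/
def stepFlip (n k : ℕ) : Equiv.Perm (Fin n → Bool) :=
  if hk : k < n then cubeFlip ⟨k, hk⟩ else 1

lemma stepFlip_of_lt {k : ℕ} (hk : k < n) : stepFlip n k = cubeFlip ⟨k, hk⟩ :=
  dif_pos hk

lemma isSymmetricMartingale_condAvg (h : (Fin n → Bool) → ℝ) :
    IsSymmetricMartingale n (stepFlip n) (fun k => condAvg (tailCoords n k) h)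
      (fun k ε => √(∑ i ∈ range k, revealDiff i h ε ^ 2)) where
  nonneg _ _ := Real.sqrt_nonneg _
  zero _ := by simp
  sq_succ k ε := by
    rw [Real.sq_sqrt (sum_nonneg fun _ _ => sq_nonneg _),
      Real.sq_sqrt (sum_nonneg fun _ _ => sq_nonneg _), sum_range_succ]
    rfl
  symm_left k hk ε := by
    rw [stepFlip_of_lt hk]
    have hmem : (⟨k, hk⟩ : Fin n) ∈ tailCoords n k := mem_tailCoords.2 (le_refl k)
    exact condAvg_cubeFlip hmem h ε
  symm_succ k hk ε := by
    rw [stepFlip_of_lt hk]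
    have := condAvg_tailCoords ⟨k, hk⟩ h ε
    dsimp only at this ⊢
    linarith
  symm_sq k hk ε := by
    rw [stepFlip_of_lt hk]
    rw [sum_congr rfl fun i hi => revealDiff_cubeFlip_sq (j := ⟨k, hk⟩)
      (Nat.lt_succ_iff.1 (mem_range.1 hi)) h ε]

lemma sqrt_rpow_eq_rpow_half (p : ℝ) {x : ℝ} (hx : 0 ≤ x) : √x ^ p = x ^ (p / 2) := by
  rw [Real.sqrt_eq_rpow, ← Real.rpow_mul hx]
  congr 1
  ring

lemma pnorm_rpow {p : ℝ} (hp : p ≠ 0) (h : (Fin n → Bool) → ℝ) :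
    pnorm p h ^ p = (∑ ε, |h ε| ^ p) / 2 ^ n := by
  rw [pnorm, ← Real.rpow_mul (by positivity), one_div_mul_cancel hp, Real.rpow_one]

lemma sum_abs_revealDiff_rpow_le {p : ℝ} (hp : 1 ≤ p) (j : Fin n) (h : (Fin n → Bool) → ℝ) :
    ∑ ε, |revealDiff j.val h ε| ^ p ≤ ∑ ε, |dflip j h ε| ^ p := by
  rw [revealDiff_eq_condAvg_dflip]
  refine (sum_abs_condAvg_rpow_le hp _ _).trans (sum_le_sum fun ε _ => ?_)
  refine Real.rpow_le_rpow (abs_nonneg _) ?_ (by linarith)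
  rw [abs_div, abs_two]
  linarith [abs_nonneg (dflip j h ε)]

lemma sum_condAvg_square_function_le {p : ℝ} (hp : 2 ≤ p) (S : Finset (Fin n))
    (h : (Fin n → Bool) → ℝ) :
    ∑ ε, √(∑ i ∈ range n, revealDiff i (condAvg Sᶜ h) ε ^ 2) ^ p ≤
      ∑ ε, (∑ j ∈ S, revealDiff j.val h ε ^ 2) ^ (p / 2) := by
  rw [← sum_condAvg Sᶜ (fun ε => (∑ j ∈ S, revealDiff j.val h ε ^ 2) ^ (p / 2))]
  refine sum_le_sum fun ε _ => ?_
  rw [sqrt_rpow_eq_rpow_half _ (sum_nonneg fun _ _ => sq_nonneg _)]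
  have h1 : ∑ i ∈ range n, revealDiff i (condAvg Sᶜ h) ε ^ 2 ≤
      condAvg Sᶜ (fun ω => ∑ j ∈ S, revealDiff j.val h ω ^ 2) ε := by
    rw [sum_range, ← sum_subset (subset_univ S), condAvg_finset_sum]
    · refine sum_le_sum fun j _ => ?_
      rw [revealDiff_condAvg]
      have := abs_condAvg_rpow_le (r := 2) (by norm_num) Sᶜ (revealDiff j.val h) ε
      simpa using this
    · intro j _ hj
      rw [revealDiff_condAvg_of_mem (mem_compl.2 hj)]
      simp
  have h2 := abs_condAvg_rpow_le (r := p / 2) (by linarith) Sᶜ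
    (fun ω => ∑ j ∈ S, revealDiff j.val h ω ^ 2) ε
  refine (Real.rpow_le_rpow (sum_nonneg fun _ _ => sq_nonneg _)
    (h1.trans (le_abs_self _)) (by linarith)).trans (h2.trans_eq ?_)
  congr 1
  ext ω
  rw [abs_of_nonneg (sum_nonneg fun _ _ => sq_nonneg _)]

end Cube

/-- **The `X_p` inequality for Rademacher chaos** (Theorem 1.6): for every `p ∈ [2,∞)` there is
`C = C(p) > 0` such that for all `n`, `k ∈ [n]` and mean-zero `h : {-1,1}^n → ℝ`,
`((1/binom(n,k)) Σ_{|S|=k} ‖E_{[n]∖S} h‖_p^p)^{1/p}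
  ≤ C ((k/n) Σ_j ‖∂_j h‖_p^p + (k/n)^{p/2} ‖h‖_p^p)^{1/p}`. -/
theorem xp_inequality_for_rademacher_chaos (p : ℝ) (hp : 2 ≤ p) :
    ∃ C : ℝ, 0 < C ∧ ∀ n : ℕ, 0 < n → ∀ k : ℕ, 1 ≤ k → k ≤ n →
      ∀ h : (Fin n → Bool) → ℝ, (∑ ε : Fin n → Bool, h ε) = 0 →
      ((∑ S ∈ powersetCard k (univ : Finset (Fin n)), pnorm p (condAvg Sᶜ h) ^ p) /
          (n.choose k)) ^ (1 / p) ≤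
        C * (((k : ℝ) / n) * ∑ j : Fin n, pnorm p (dflip j h) ^ p +
          ((k : ℝ) / n) ^ (p / 2) * pnorm p h ^ p) ^ (1 / p) := by
  obtain ⟨C₁, hC₁, lower⟩ := exists_square_function_lower hp
  obtain ⟨C₂, hC₂, upper⟩ := exists_square_function_upper hp
  obtain ⟨C₃, hC₃, random⟩ := exists_sum_powersetCard_rpow_le (r := p / 2) (by linarith)
  have hp0 : p ≠ 0 := by linarith
  set D : ℝ := C₁ * (C₃ * (1 + C₂)) with hD
  have hD0 : 0 < D := by positivity
  refine ⟨D ^ (1 / p), by positivity, fun n hn k hk hkn h h0 => ?_⟩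
  simp only [pnorm_rpow hp0]
  have hn0 : (0 : ℝ) < n := by exact_mod_cast hn
  rw [← Real.mul_rpow hD0.le (by positivity)]
  refine Real.rpow_le_rpow (by positivity) ?_ (by positivity)
  set N : ℝ := (n.choose k : ℝ) with hN
  have hN0 : 0 < N := Nat.cast_pos.2 (Nat.choose_pos hkn)
  rw [div_le_iff₀ hN0, ← sum_div, ← sum_div, div_le_iff₀ (by positivity)]
  have h1 : ∀ S : Finset (Fin n), ∑ ε, |condAvg Sᶜ h ε| ^ p ≤
      C₁ * ∑ ε, (∑ j ∈ S, revealDiff j.val h ε ^ 2) ^ (p / 2) := by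
    intro S
    have e1 : tailCoords n n = ∅ := by
      ext j; simp [mem_tailCoords]
    have e0 : tailCoords n 0 = univ := by
      ext j; simp [mem_tailCoords]
    have := lower _ _ _ _ _ (isSymmetricMartingale_condAvg (condAvg Sᶜ h)) (fun ε => by
      rw [e0, condAvg_univ, sum_condAvg, h0, zero_div])
    rw [e1, condAvg_empty] at this
    exact this.trans (mul_le_mul_of_nonneg_left (sum_condAvg_square_function_le hp S h) hC₁.le)
  have h2 : ∑ ε, (∑ j : Fin n, revealDiff j.val h ε ^ 2) ^ (p / 2) ≤ C₂ * ∑ ε, |h ε| ^ p := by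
    have e1 : tailCoords n n = ∅ := by
      ext j; simp [mem_tailCoords]
    have := upper _ _ _ _ _ (isSymmetricMartingale_condAvg h)
    rw [e1, condAvg_empty] at this
    refine le_trans (sum_le_sum fun ε _ => ?_) this
    rw [sqrt_rpow_eq_rpow_half _ (sum_nonneg fun _ _ => sq_nonneg _), sum_range]
  have h3 : ∑ ε, ∑ j : Fin n, (revealDiff j.val h ε ^ 2) ^ (p / 2) ≤
      ∑ j : Fin n, ∑ ε, |dflip j h ε| ^ p := by
    rw [sum_comm]
    refine sum_le_sum fun j _ => le_trans (le_of_eq ?_)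
      (sum_abs_revealDiff_rpow_le (by linarith) j h)
    refine sum_congr rfl fun ε _ => ?_
    rw [← sqrt_rpow_eq_rpow_half _ (sq_nonneg _), Real.sqrt_sq_eq_abs]
  set κ : ℝ := (k : ℝ) / n with hκ
  have hκ0 : 0 ≤ κ := by positivity
  have hκp : 0 ≤ κ ^ (p / 2) := by positivity
  have h4 : ∑ S ∈ powersetCard k (univ : Finset (Fin n)), ∑ ε, |condAvg Sᶜ h ε| ^ p ≤
      C₁ * ∑ ε, N * (C₃ * (κ * ∑ j : Fin n, (revealDiff j.val h ε ^ 2) ^ (p / 2) +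
        κ ^ (p / 2) * (∑ j : Fin n, revealDiff j.val h ε ^ 2) ^ (p / 2))) := by
    refine (sum_le_sum fun S _ => h1 S).trans ?_
    rw [← mul_sum, sum_comm]
    exact mul_le_mul_of_nonneg_left (sum_le_sum fun ε _ =>
      random n k hk hkn _ fun _ => sq_nonneg _) hC₁.le
  rw [← mul_sum, ← mul_sum, sum_add_distrib, ← mul_sum, ← mul_sum] at h4
  set U := ∑ j : Fin n, ∑ ε, |dflip j h ε| ^ p
  set V := ∑ ε, |h ε| ^ p
  have hU : 0 ≤ U := sum_nonneg fun _ _ => sum_nonneg fun _ _ => by positivity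
  have hV : 0 ≤ V := sum_nonneg fun _ _ => by positivity
  have h5 := add_le_add (mul_le_mul_of_nonneg_left h3 hκ0) (mul_le_mul_of_nonneg_left h2 hκp)
  have h6 : κ * U + κ ^ (p / 2) * (C₂ * V) ≤ (1 + C₂) * (κ * U + κ ^ (p / 2) * V) := by
    nlinarith [mul_nonneg hC₂.le (mul_nonneg hκ0 hU), mul_nonneg hκp hV]
  have h7 := mul_le_mul_of_nonneg_left (h5.trans h6)
    (mul_nonneg hC₁.le (mul_nonneg hN0.le hC₃.le))
  have h8 : D * (κ * (U / 2 ^ n) + κ ^ (p / 2) * (V / 2 ^ n)) * N * 2 ^ n =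
      C₁ * (N * C₃) * ((1 + C₂) * (κ * U + κ ^ (p / 2) * V)) := by
    rw [hD]
    field_simp
  rw [h8]
  linarith
end

section
/- There exists a universal constant C ∈ (0, ∞) such that for every p ∈ [2, ∞) and every α ∈ (0, ∞) with α ≤ (5 + log p)/4, for every n ∈ ℕ and every h ∈ L_p^0({−1,1}^n), ‖Δ_{[n]}^{−α} h‖_p ≤ C · (log p)^α / (2^α · Γ(1+α)) · ‖h‖_p, where Γ is the Gamma function. Equivalently, sup_{n∈ℕ} ‖Δ_{[n]}^{−α}‖_{p→p} ≤ C·(log p)^α/(2^α Γ(1+α)). -/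
open Finset

/-- The Walsh function `W_A(ε) = Π_{j ∈ A} ε_j`. -/
def walsh {n : ℕ} (A : Finset (Fin n)) (ε : Fin n → Bool) : ℝ :=
  ∏ j ∈ A, (if ε j then (1 : ℝ) else -1)

/-- The Fourier–Walsh coefficient `ĥ(A) = 2^{-n} Σ_ε h(ε) W_A(ε)`. -/
noncomputable def fourierCoef {n : ℕ} (h : (Fin n → Bool) → ℝ) (A : Finset (Fin n)) : ℝ :=
  (∑ ε : Fin n → Bool, h ε * walsh A ε) / 2 ^ n

/-- `Δ_S^α h = Σ_{A ∩ S ≠ ∅} |A ∩ S|^α ĥ(A) W_A`. -/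
noncomputable def deltaPow {n : ℕ} (S : Finset (Fin n)) (α : ℝ) (h : (Fin n → Bool) → ℝ) :
    (Fin n → Bool) → ℝ :=
  fun ε => ∑ A : Finset (Fin n),
    if (A ∩ S).Nonempty then ((A ∩ S).card : ℝ) ^ α * fourierCoef h A * walsh A ε else 0

/-- Flipping the `a`-th coordinate of the hypercube. -/
def flipAt {n : ℕ} (a : Fin n) : (Fin n → Bool) ≃ (Fin n → Bool) :=
  Function.Involutive.toPerm (fun ε => Function.update ε a (!ε a)) (fun ε => by simp)

lemma flipAt_apply {n : ℕ} (a : Fin n) (ε : Fin n → Bool) :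
    flipAt a ε = Function.update ε a (!ε a) := rfl

lemma walsh_flipAt {n : ℕ} (a : Fin n) (A : Finset (Fin n)) (ε : Fin n → Bool) :
    walsh A (flipAt a ε) = (if a ∈ A then -1 else 1) * walsh A ε := by
  have h : ∀ j, (if flipAt a ε j then (1 : ℝ) else -1)
      = (if a = j then -1 else 1) * (if ε j then (1 : ℝ) else -1) := by
    intro j
    by_cases hj : a = j
    · subst hj
      cases h : ε a <;> simp [flipAt_apply, h]
    · simp [flipAt_apply, Function.update_of_ne (Ne.symm hj), hj]
  simp only [walsh, h, prod_mul_distrib, prod_ite_eq]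

lemma walsh_insert {n : ℕ} {a : Fin n} {A : Finset (Fin n)} (ha : a ∉ A) (ε : Fin n → Bool) :
    walsh (insert a A) ε = (if ε a then 1 else -1) * walsh A ε := by
  simp [walsh, prod_insert ha]

lemma sum_walsh_mul_walsh {n : ℕ} (ε δ : Fin n → Bool) :
    ∑ A : Finset (Fin n), walsh A ε * walsh A δ = if ε = δ then 2 ^ n else 0 := by
  have h1 : ∑ A : Finset (Fin n), walsh A ε * walsh A δ
      = ∏ j, (1 + (if ε j then (1 : ℝ) else -1) * (if δ j then (1 : ℝ) else -1)) := by
    rw [prod_one_add, powerset_univ]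
    simp only [walsh, prod_mul_distrib]
  rw [h1]
  split_ifs with h
  · subst h
    have : ∀ j, (1 + (if ε j then (1 : ℝ) else -1) * (if ε j then (1 : ℝ) else -1)) = 2 := by
      intro j
      cases ε j <;> norm_num
    simp only [this, prod_const, card_univ, Fintype.card_fin]
  · obtain ⟨j, hj⟩ := Function.ne_iff.1 h
    refine prod_eq_zero (mem_univ j) ?_
    revert hj
    cases ε j <;> cases δ j <;> norm_num

lemma sum_fourierCoef_mul_walsh {n : ℕ} (h : (Fin n → Bool) → ℝ) (ε : Fin n → Bool) :
    ∑ A : Finset (Fin n), fourierCoef h A * walsh A ε = h ε := by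
  simp only [fourierCoef, div_mul_eq_mul_div, sum_mul, ← sum_div]
  rw [sum_comm]
  simp only [mul_assoc, ← mul_sum, sum_walsh_mul_walsh]
  simp

lemma sum_fourierCoef_sq {n : ℕ} (h : (Fin n → Bool) → ℝ) :
    ∑ A : Finset (Fin n), fourierCoef h A ^ 2 = (∑ ε, h ε ^ 2) / 2 ^ n := by
  have h1 : ∀ A : Finset (Fin n), fourierCoef h A ^ 2
      = (∑ ε, h ε * (fourierCoef h A * walsh A ε)) / 2 ^ n := by
    intro A
    rw [sq]
    nth_rewrite 1 [fourierCoef]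
    rw [div_mul_eq_mul_div, sum_mul]
    congr 1
    exact sum_congr rfl fun ε _ => by ring
  simp only [h1, ← sum_div]
  rw [sum_comm]
  simp only [← mul_sum, sum_fourierCoef_mul_walsh, sq]

lemma pnorm_eq_norm_toLp {n : ℕ} {p : ℝ} (hp : 1 ≤ p) (h : (Fin n → Bool) → ℝ) :
    pnorm p h = (1 / 2 ^ n : ℝ) ^ (1 / p) * ‖WithLp.toLp (ENNReal.ofReal p) h‖ := by
  have hp' : (ENNReal.ofReal p).toReal = p := ENNReal.toReal_ofReal (by linarith)
  rw [PiLp.norm_eq_sum (by rw [hp']; linarith), hp', pnorm, div_eq_inv_mul,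
    Real.mul_rpow (by positivity) (by positivity), one_div ((2 : ℝ) ^ n)]
  simp [Real.norm_eq_abs]

lemma pnorm_nonneg {n : ℕ} (p : ℝ) (h : (Fin n → Bool) → ℝ) : 0 ≤ pnorm p h := by
  unfold pnorm
  positivity

lemma pnorm_add_le {n : ℕ} {p : ℝ} (hp : 1 ≤ p) (f g : (Fin n → Bool) → ℝ) :
    pnorm p (f + g) ≤ pnorm p f + pnorm p g := by
  have : Fact (1 ≤ ENNReal.ofReal p) := ⟨by simpa using hp⟩
  simp only [pnorm_eq_norm_toLp hp, ← mul_add]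
  gcongr
  rw [WithLp.toLp_add]
  exact norm_add_le _ _

lemma pnorm_smul {n : ℕ} {p : ℝ} (hp : 1 ≤ p) (c : ℝ) (f : (Fin n → Bool) → ℝ) :
    pnorm p (c • f) = |c| * pnorm p f := by
  have : Fact (1 ≤ ENNReal.ofReal p) := ⟨by simpa using hp⟩
  simp only [pnorm_eq_norm_toLp hp]
  rw [WithLp.toLp_smul, norm_smul, Real.norm_eq_abs]
  ring

lemma pnorm_comp_equiv {n : ℕ} (p : ℝ) (e : (Fin n → Bool) ≃ (Fin n → Bool))
    (f : (Fin n → Bool) → ℝ) : pnorm p (fun ε => f (e ε)) = pnorm p f := by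
  unfold pnorm
  rw [Equiv.sum_comp e (fun ε => |f ε| ^ p)]

/-- Minkowski's integral inequality for `pnorm`. -/
lemma pnorm_integral_le {n : ℕ} {p : ℝ} (hp : 1 ≤ p) {S : Set ℝ} (hS : MeasurableSet S)
    {F : ℝ → (Fin n → Bool) → ℝ} {G : ℝ → ℝ}
    (hF : ∀ ε, MeasureTheory.IntegrableOn (fun t => F t ε) S)
    (hG : MeasureTheory.IntegrableOn G S) (hb : ∀ t ∈ S, pnorm p (F t) ≤ G t) :
    pnorm p (fun ε => ∫ t in S, F t ε) ≤ ∫ t in S, G t := by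
  have : Fact (1 ≤ ENNReal.ofReal p) := ⟨by simpa using hp⟩
  let μ := MeasureTheory.volume.restrict S
  have hFi : MeasureTheory.Integrable
      (fun t => (WithLp.toLp (ENNReal.ofReal p) (F t) :
        PiLp (ENNReal.ofReal p) (fun _ : Fin n → Bool => ℝ))) μ :=
    MeasureTheory.Integrable.of_eval_piLp hF
  have heq : WithLp.toLp (ENNReal.ofReal p) (fun ε => ∫ t in S, F t ε)
      = ∫ t in S, (WithLp.toLp (ENNReal.ofReal p) (F t) :
          PiLp (ENNReal.ofReal p) (fun _ : Fin n → Bool => ℝ)) := by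
    ext ε
    rw [MeasureTheory.eval_integral_piLp hF]
  rw [pnorm_eq_norm_toLp hp, heq]
  calc _ ≤ (1 / 2 ^ n : ℝ) ^ (1 / p) * ∫ t in S, ‖WithLp.toLp (ENNReal.ofReal p) (F t)‖ := by
        gcongr
        exact MeasureTheory.norm_integral_le_integral_norm _
    _ = ∫ t in S, pnorm p (F t) := by
        rw [← MeasureTheory.integral_const_mul]
        simp only [pnorm_eq_norm_toLp hp]
    _ ≤ _ := by
        refine MeasureTheory.setIntegral_mono_on ?_ hG hS hb
        simp only [pnorm_eq_norm_toLp hp]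
        exact hFi.norm.const_mul _

lemma pnorm_mono_exponent {n : ℕ} {p q : ℝ} (hp : 0 < p) (hpq : p ≤ q)
    (f : (Fin n → Bool) → ℝ) : pnorm p f ≤ pnorm q f := by
  have hq : 0 < q := hp.trans_le hpq
  have key := Real.rpow_arith_mean_le_arith_mean_rpow (univ : Finset (Fin n → Bool))
    (fun _ => (1 / 2 ^ n : ℝ)) (fun ε => |f ε| ^ p) (fun _ _ => by positivity)
    (by simp) (fun _ _ => by positivity) (p := q / p) ((one_le_div hp).2 hpq)
  simp only [← Real.rpow_mul (abs_nonneg _), mul_div_cancel₀ q hp.ne', one_div_mul_eq_div,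
    ← sum_div] at key
  unfold pnorm
  calc _ = (((∑ ε, |f ε| ^ p) / 2 ^ n) ^ (q / p)) ^ (1 / q) := by
        rw [← Real.rpow_mul (by positivity)]
        congr 1
        field_simp
    _ ≤ _ := Real.rpow_le_rpow (by positivity) key (by positivity)

/-- The noise operator `h ↦ ∑ A, ρ ^ |A| ĥ(A) W_A`. -/
noncomputable def noise {n : ℕ} (ρ : ℝ) (h : (Fin n → Bool) → ℝ) : (Fin n → Bool) → ℝ :=
  fun ε => ∑ A : Finset (Fin n), ρ ^ #A * fourierCoef h A * walsh A ε

lemma pnorm_noise_le {n : ℕ} {p ρ : ℝ} (hp : 1 ≤ p) (hρ0 : 0 ≤ ρ) (hρ1 : ρ ≤ 1)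
    (h : (Fin n → Bool) → ℝ) : pnorm p (noise ρ h) ≤ pnorm p h := by
  have key : ∀ T : Finset (Fin n), pnorm p
      (fun ε => ∑ A : Finset (Fin n), ρ ^ #(A ∩ T) * fourierCoef h A * walsh A ε) ≤ pnorm p h := by
    intro T
    induction T using Finset.induction_on with
    | empty => simp [sum_fourierCoef_mul_walsh]
    | insert a T ha ih =>
      set f : (Fin n → Bool) → ℝ :=
        fun ε => ∑ A : Finset (Fin n), ρ ^ #(A ∩ T) * fourierCoef h A * walsh A ε with hf
      have heq : (fun ε => ∑ A : Finset (Fin n),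
          ρ ^ #(A ∩ insert a T) * fourierCoef h A * walsh A ε)
          = ((1 + ρ) / 2) • f + ((1 - ρ) / 2) • (fun ε => f (flipAt a ε)) := by
        ext ε
        simp only [hf, Pi.add_apply, Pi.smul_apply, smul_eq_mul, mul_sum, ← sum_add_distrib]
        refine sum_congr rfl fun A _ => ?_
        rw [walsh_flipAt]
        by_cases hA : a ∈ A
        · rw [inter_insert_of_mem hA, card_insert_of_notMem (by simp [ha])]
          simp only [hA, if_true]
          ring
        · rw [inter_insert_of_notMem hA]
          simp only [hA, if_false]
          ring
      rw [heq]
      refine (pnorm_add_le hp _ _).trans ?_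
      rw [pnorm_smul hp, pnorm_smul hp, pnorm_comp_equiv, abs_of_nonneg (by linarith),
        abs_of_nonneg (by linarith)]
      linarith
  have huniv := key univ
  simp only [inter_univ] at huniv
  exact huniv

lemma choose_two_mul_le (k j : ℕ) :
    (2 * k).choose (2 * j) ≤ k.choose j * (2 * k) ^ j := by
  induction j with
  | zero => simp
  | succ j ih =>
    rcases lt_or_ge j k with hjk | hjk
    · obtain ⟨m, rfl⟩ := Nat.exists_eq_add_of_lt hjk
      have e1 := Nat.choose_succ_right_eq (2 * (j + m + 1)) (2 * j)
      have e2 := Nat.choose_succ_right_eq (2 * (j + m + 1)) (2 * j + 1)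
      have e3 := Nat.choose_succ_right_eq (j + m + 1) j
      rw [show 2 * (j + m + 1) - 2 * j = 2 * (m + 1) by omega] at e1
      rw [show 2 * (j + m + 1) - (2 * j + 1) = 2 * m + 1 by omega] at e2
      rw [show j + m + 1 - j = m + 1 by omega] at e3
      rw [show 2 * (j + 1) = 2 * j + 1 + 1 by ring]
      set K := 2 * (j + m + 1) with hK
      refine Nat.le_of_mul_le_mul_right (c := (2 * j + 1 + 1) * (2 * j + 1)) ?_ (by positivity)
      calc K.choose (2 * j + 1 + 1) * ((2 * j + 1 + 1) * (2 * j + 1))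
          = K.choose (2 * j) * (2 * (m + 1) * (2 * m + 1)) := by
            rw [← mul_assoc, e2, mul_right_comm, e1]; ring
        _ ≤ ((j + m + 1).choose j * K ^ j) * (2 * (m + 1) * (2 * m + 1)) :=
            Nat.mul_le_mul_right _ ih
        _ = (j + m + 1).choose (j + 1) * K ^ j * (2 * (j + 1)) * (2 * m + 1) := by
            rw [show (j + m + 1).choose (j + 1) * K ^ j * (2 * (j + 1)) * (2 * m + 1)
                = (j + m + 1).choose (j + 1) * (j + 1) * (K ^ j * 2 * (2 * m + 1)) by ring, e3]
            ring
        _ ≤ (j + m + 1).choose (j + 1) * K ^ j * (2 * (j + 1)) * (K * (2 * j + 1)) := by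
            gcongr
            nlinarith
        _ = _ := by ring
    · rw [Nat.choose_eq_zero_of_lt (by omega)]
      exact Nat.zero_le _

lemma sum_range_two_mul_add_one (f : ℕ → ℝ) (k : ℕ) :
    ∑ m ∈ range (2 * k + 1), f m
      = ∑ j ∈ range (k + 1), f (2 * j) + ∑ j ∈ range k, f (2 * j + 1) := by
  induction k with
  | zero => simp
  | succ k ih =>
    rw [show 2 * (k + 1) + 1 = 2 * k + 1 + 1 + 1 by ring, sum_range_succ, sum_range_succ, ih,
      sum_range_succ _ (k + 1), sum_range_succ (fun j => f (2 * j + 1)) k,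
      show 2 * (k + 1) = 2 * k + 1 + 1 by ring]
    ring

lemma two_point_pow_le (k : ℕ) (x y : ℝ) :
    (y + x) ^ (2 * k) + (-y + x) ^ (2 * k) ≤ 2 * (2 * k * y ^ 2 + x ^ 2) ^ k := by
  rw [add_pow, add_pow, add_pow, ← sum_add_distrib, sum_range_two_mul_add_one]
  have hodd : ∑ j ∈ range k, (y ^ (2 * j + 1) * x ^ (2 * k - (2 * j + 1))
      * ((2 * k).choose (2 * j + 1) : ℝ) + (-y) ^ (2 * j + 1) * x ^ (2 * k - (2 * j + 1))
      * ((2 * k).choose (2 * j + 1) : ℝ)) = 0 := by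
    refine sum_eq_zero fun j _ => ?_
    rw [Odd.neg_pow ⟨j, rfl⟩]
    ring
  rw [hodd, add_zero, mul_sum]
  refine sum_le_sum fun j _ => ?_
  rw [Even.neg_pow ⟨j, by ring⟩, ← Nat.mul_sub, pow_mul, pow_mul, mul_pow]
  have h : ((2 * k).choose (2 * j) : ℝ) ≤ k.choose j * (2 * k) ^ j := by
    exact_mod_cast choose_two_mul_le k j
  have h0 : 0 ≤ (y ^ 2) ^ j * (x ^ 2) ^ (k - j) := by positivity
  nlinarith [mul_le_mul_of_nonneg_left h h0]

lemma pnorm_natCast_pow {n k : ℕ} (hk : k ≠ 0) (g : (Fin n → Bool) → ℝ) :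
    pnorm k g ^ k = (∑ ε, |g ε| ^ k) / 2 ^ n := by
  simp only [pnorm, Real.rpow_natCast, one_div]
  exact Real.rpow_inv_natCast_pow (by positivity) hk

/-- Hypercontractivity from `L_2` to `L_{2k}` for Walsh polynomials. -/
lemma sum_pow_walsh_le {n k : ℕ} (hk : k ≠ 0) {ρ : ℝ} (hρ : 2 * k * ρ ^ 2 ≤ 1)
    (T : Finset (Fin n)) (c : Finset (Fin n) → ℝ) :
    (∑ ε, (∑ A ∈ T.powerset, ρ ^ #A * c A * walsh A ε) ^ (2 * k)) / 2 ^ n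
      ≤ (∑ A ∈ T.powerset, c A ^ 2) ^ k := by
  induction T using Finset.induction_on generalizing c with
  | empty => simp [walsh, ← pow_mul]
  | insert a T ha ih =>
    set u : (Fin n → Bool) → ℝ := fun ε => ∑ A ∈ T.powerset, ρ ^ #A * c A * walsh A ε with hu
    set v : (Fin n → Bool) → ℝ :=
      fun ε => ∑ A ∈ T.powerset, ρ ^ #A * c (insert a A) * walsh A ε with hv
    set s : (Fin n → Bool) → ℝ := fun ε => if ε a then 1 else -1 with hs
    have hmem : ∀ A ∈ T.powerset, a ∉ A := fun A hA h => ha (mem_powerset.1 hA h)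
    have hF : ∀ ε, ∑ A ∈ (insert a T).powerset, ρ ^ #A * c A * walsh A ε
        = ρ * s ε * v ε + u ε := by
      intro ε
      rw [sum_powerset_insert ha, add_comm, hv, mul_sum]
      congr 1
      refine sum_congr rfl fun A hA => ?_
      rw [card_insert_of_notMem (hmem A hA), walsh_insert (hmem A hA)]
      ring
    have hflip : ∀ (d : Finset (Fin n) → ℝ) (ε : Fin n → Bool),
        ∑ A ∈ T.powerset, d A * walsh A (flipAt a ε) = ∑ A ∈ T.powerset, d A * walsh A ε :=
      fun d ε => sum_congr rfl fun A hA => by rw [walsh_flipAt, if_neg (hmem A hA), one_mul]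
    have hsflip : ∀ ε, s (flipAt a ε) = -s ε := by
      intro ε
      cases h : ε a <;> simp [hs, flipAt_apply, h]
    have hs2 : ∀ ε, s ε ^ 2 = 1 := by
      intro ε
      cases h : ε a <;> simp [hs, h]
    have h1 : ∑ ε, (ρ * s ε * v ε + u ε) ^ (2 * k) ≤ ∑ ε, |u ε ^ 2 + v ε ^ 2| ^ k := by
      have h2 : ∑ ε, (-(ρ * s ε * v ε) + u ε) ^ (2 * k) = ∑ ε, (ρ * s ε * v ε + u ε) ^ (2 * k) := by
        rw [← Equiv.sum_comp (flipAt a)]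
        refine sum_congr rfl fun ε _ => ?_
        rw [hsflip]
        simp only [hu, hv, hflip]
        ring_nf
      have h3 : ∀ ε, (ρ * s ε * v ε + u ε) ^ (2 * k) + (-(ρ * s ε * v ε) + u ε) ^ (2 * k)
          ≤ 2 * |u ε ^ 2 + v ε ^ 2| ^ k := by
        intro ε
        refine (two_point_pow_le k (u ε) (ρ * s ε * v ε)).trans ?_
        rw [abs_of_nonneg (by positivity)]
        gcongr 2 * ?_ ^ k
        rw [mul_pow, mul_pow, hs2]
        nlinarith [mul_le_mul_of_nonneg_right hρ (sq_nonneg (v ε))]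
      have h4 := sum_le_sum fun ε (_ : ε ∈ (univ : Finset (Fin n → Bool))) => h3 ε
      rw [sum_add_distrib, h2, ← mul_sum] at h4
      linarith
    have hk1 : (1 : ℝ) ≤ k := by exact_mod_cast Nat.one_le_iff_ne_zero.2 hk
    have hsq : ∀ d : Finset (Fin n) → ℝ,
        pnorm k (fun ε => (∑ A ∈ T.powerset, ρ ^ #A * d A * walsh A ε) ^ 2)
          ≤ ∑ A ∈ T.powerset, d A ^ 2 := by
      intro d
      refine (pow_le_pow_iff_left₀ (pnorm_nonneg _ _) (by positivity) hk).1 ?_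
      rw [pnorm_natCast_pow hk]
      simpa only [abs_pow, sq_abs, ← pow_mul] using ih d
    simp only [hF]
    calc _ ≤ (∑ ε, |u ε ^ 2 + v ε ^ 2| ^ k) / 2 ^ n := by gcongr
      _ = pnorm k ((fun ε => u ε ^ 2) + fun ε => v ε ^ 2) ^ k := by
          rw [pnorm_natCast_pow hk]
          rfl
      _ ≤ _ := by
          refine pow_le_pow_left₀ (pnorm_nonneg _ _) ?_ k
          rw [sum_powerset_insert ha]
          exact (pnorm_add_le hk1 _ _).trans (add_le_add (hsq c) (hsq fun A => c (insert a A)))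

lemma pnorm_noise_mul_le {n : ℕ} {p ρ r : ℝ} (hp : 2 ≤ p) (hρ : 2 * p * ρ ^ 2 ≤ 1)
    (hr0 : 0 ≤ r) (hr1 : r ≤ 1) {h : (Fin n → Bool) → ℝ} (hh : ∑ ε, h ε = 0) :
    pnorm p (noise (ρ * r) h) ≤ r * pnorm p h := by
  set k := ⌈p / 2⌉₊ with hkdef
  have hpk : p ≤ (2 * k : ℕ) := by
    have := Nat.le_ceil (p / 2)
    push_cast
    linarith
  have hkp : (2 * k : ℝ) ≤ 2 * p := by
    have := Nat.ceil_lt_add_one (show 0 ≤ p / 2 by linarith)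
    linarith
  have hk : k ≠ 0 := by
    rintro h0
    rw [h0] at hpk
    norm_num at hpk
    linarith
  have hcoef : ∑ A : Finset (Fin n), (r ^ #A * fourierCoef h A) ^ 2 ≤ (r * pnorm p h) ^ 2 := by
    calc _ ≤ ∑ A : Finset (Fin n), r ^ 2 * fourierCoef h A ^ 2 := by
          refine sum_le_sum fun A _ => ?_
          rcases A.eq_empty_or_nonempty with rfl | hA
          · simp [fourierCoef, walsh, hh]
          · rw [mul_pow]
            gcongr
            exact pow_le_of_le_one hr0 hr1 hA.card_ne_zero
      _ = r ^ 2 * pnorm (2 : ℕ) h ^ 2 := by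
          rw [← mul_sum, sum_fourierCoef_sq, pnorm_natCast_pow two_ne_zero]
          simp only [sq_abs]
      _ ≤ r ^ 2 * pnorm p h ^ 2 := by
          gcongr
          · exact pnorm_nonneg _ _
          · exact pnorm_mono_exponent (by norm_num) (by exact_mod_cast hp) _
      _ = _ := by ring
  refine (pnorm_mono_exponent (by linarith) hpk _).trans ?_
  refine (pow_le_pow_iff_left₀ (pnorm_nonneg _ _) (mul_nonneg hr0 (pnorm_nonneg _ _))
    (by omega : 2 * k ≠ 0)).1 ?_
  rw [pnorm_natCast_pow (by omega)]
  have key := sum_pow_walsh_le hk (ρ := ρ) ((mul_le_mul_of_nonneg_right hkp (sq_nonneg ρ)).trans hρ)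
    univ (fun A => r ^ #A * fourierCoef h A)
  rw [powerset_univ] at key
  rw [pow_mul (r * pnorm p h)]
  refine le_trans (le_of_eq ?_) (key.trans (pow_le_pow_left₀ (by positivity) hcoef k))
  congr 1
  refine sum_congr rfl fun ε _ => ?_
  rw [(even_two_mul k).pow_abs, noise]
  simp only [mul_pow, mul_assoc]

lemma integrableOn_rpow_mul_exp_neg_mul {α r : ℝ} (hα : 0 < α) (hr : 0 < r) :
    MeasureTheory.IntegrableOn (fun t : ℝ => t ^ (α - 1) * Real.exp (-(r * t))) (Set.Ioi 0) := by
  refine MeasureTheory.Integrable.of_integral_ne_zero ?_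
  rw [Real.integral_rpow_mul_exp_neg_mul_Ioi hα hr]
  have := Real.Gamma_pos_of_pos hα
  positivity

lemma integrableOn_rpow_mul_noise {n : ℕ} {α : ℝ} (hα : 0 < α) {h : (Fin n → Bool) → ℝ}
    (hh : ∑ ε, h ε = 0) (ε : Fin n → Bool) :
    MeasureTheory.IntegrableOn (fun t : ℝ => t ^ (α - 1) * noise (Real.exp (-t)) h ε)
      (Set.Ioi 0) := by
  simp only [noise, mul_sum]
  refine MeasureTheory.integrable_finsetSum _ fun A _ => ?_
  rcases A.eq_empty_or_nonempty with rfl | hA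
  · simp [fourierCoef, walsh, hh]
  · have := (integrableOn_rpow_mul_exp_neg_mul hα (r := #A) (by exact_mod_cast hA.card_pos)).mul_const
      (fourierCoef h A * walsh A ε)
    refine this.congr (Filter.Eventually.of_forall fun t => ?_)
    simp only [← Real.exp_nat_mul]
    ring_nf

lemma Gamma_mul_deltaPow {n : ℕ} {α : ℝ} (hα : 0 < α) {h : (Fin n → Bool) → ℝ}
    (hh : ∑ ε, h ε = 0) (ε : Fin n → Bool) :
    Real.Gamma α * deltaPow univ (-α) h ε
      = ∫ t in Set.Ioi 0, t ^ (α - 1) * noise (Real.exp (-t)) h ε := by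
  have hterm : ∀ A : Finset (Fin n), ∀ t : ℝ,
      t ^ (α - 1) * (Real.exp (-t) ^ #A * fourierCoef h A * walsh A ε)
        = t ^ (α - 1) * Real.exp (-(#A * t)) * (fourierCoef h A * walsh A ε) := by
    intro A t
    rw [← Real.exp_nat_mul]
    ring_nf
  simp only [noise, mul_sum, deltaPow, hterm]
  have h0 : fourierCoef h ∅ = 0 := by simp [fourierCoef, walsh, hh]
  rw [MeasureTheory.integral_finsetSum]
  · refine sum_congr rfl fun A _ => ?_
    rcases A.eq_empty_or_nonempty with rfl | hA
    · simp [h0]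
    · have hc : (0 : ℝ) < #A := by exact_mod_cast hA.card_pos
      rw [MeasureTheory.integral_mul_const, Real.integral_rpow_mul_exp_neg_mul_Ioi hα hc,
        inter_univ, if_pos hA, Real.rpow_neg hc.le, one_div, Real.inv_rpow hc.le]
      ring
  · intro A _
    rcases A.eq_empty_or_nonempty with rfl | hA
    · simp [h0]
    · exact (integrableOn_rpow_mul_exp_neg_mul hα (by exact_mod_cast hA.card_pos)).mul_const _

lemma rpow_sub_one_le_mul_exp {α T t : ℝ} (hT : 0 < T) (hαT : α - 1 ≤ T / 2) (ht : T ≤ t) :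
    t ^ (α - 1) ≤ T ^ (α - 1) * Real.exp ((t - T) / 2) := by
  have ht0 : 0 < t := hT.trans_le ht
  have hmul : t ^ (α - 1) = T ^ (α - 1) * (t / T) ^ (α - 1) := by
    rw [← Real.mul_rpow hT.le (by positivity), mul_div_cancel₀ _ hT.ne']
  rw [hmul]
  gcongr
  rw [Real.rpow_def_of_pos (by positivity)]
  gcongr
  have h1 : 0 ≤ Real.log (t / T) := Real.log_nonneg ((one_le_div hT).2 ht)
  have h2 : Real.log (t / T) ≤ t / T - 1 := Real.log_le_sub_one_of_pos (by positivity)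
  calc _ ≤ (t / T - 1) * (T / 2) := by nlinarith
    _ = _ := by field_simp

lemma pnorm_deltaPow_neg_le {n : ℕ} {p α T : ℝ} (hp : 2 ≤ p) (hα : 0 < α) (hT : 0 < T)
    (hTp : 2 * p * Real.exp (-T) ^ 2 ≤ 1) (hαT : α - 1 ≤ T / 2)
    {h : (Fin n → Bool) → ℝ} (hh : ∑ ε, h ε = 0) :
    Real.Gamma α * pnorm p (deltaPow univ (-α) h)
      ≤ (T ^ α / α + 2 * T ^ (α - 1)) * pnorm p h := by
  have hp1 : 1 ≤ p := by linarith
  have hFint := fun ε => integrableOn_rpow_mul_noise hα hh ε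
  have hsub1 : Set.Ioc 0 T ⊆ Set.Ioi 0 := Set.Ioc_subset_Ioi_self
  have hsub2 : Set.Ioi T ⊆ Set.Ioi 0 := Set.Ioi_subset_Ioi hT.le
  have hnorm : ∀ t : ℝ, 0 < t → pnorm p (fun ε => t ^ (α - 1) * noise (Real.exp (-t)) h ε)
      = t ^ (α - 1) * pnorm p (noise (Real.exp (-t)) h) := by
    intro t ht
    have := pnorm_smul hp1 (t ^ (α - 1)) (noise (Real.exp (-t)) h)
    rwa [abs_of_nonneg (by positivity)] at this
  have hsplit : Real.Gamma α • deltaPow univ (-α) h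
      = (fun ε => ∫ t in Set.Ioc 0 T, t ^ (α - 1) * noise (Real.exp (-t)) h ε)
        + fun ε => ∫ t in Set.Ioi T, t ^ (α - 1) * noise (Real.exp (-t)) h ε := by
    ext ε
    rw [Pi.smul_apply, smul_eq_mul, Gamma_mul_deltaPow hα hh, Pi.add_apply,
      ← Set.Ioc_union_Ioi_eq_Ioi hT.le,
      MeasureTheory.setIntegral_union Set.Ioc_disjoint_Ioi_same measurableSet_Ioi
        ((hFint ε).mono_set hsub1) ((hFint ε).mono_set hsub2)]
  have hI1 : MeasureTheory.IntegrableOn (fun t : ℝ => t ^ (α - 1)) (Set.Ioc 0 T) :=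
    (intervalIntegrable_iff_integrableOn_Ioc_of_le hT.le).1
      (intervalIntegral.intervalIntegrable_rpow' (by linarith))
  have hhead : pnorm p (fun ε => ∫ t in Set.Ioc 0 T, t ^ (α - 1) * noise (Real.exp (-t)) h ε)
      ≤ T ^ α / α * pnorm p h := by
    refine (pnorm_integral_le hp1 measurableSet_Ioc (fun ε => (hFint ε).mono_set hsub1)
      (hI1.mul_const (pnorm p h)) fun t ht => ?_).trans (le_of_eq ?_)
    · rw [hnorm t ht.1]
      have := ht.1
      gcongr
      exact pnorm_noise_le hp1 (Real.exp_nonneg _) (Real.exp_le_one_iff.2 (by linarith)) h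
    · rw [MeasureTheory.integral_mul_const, ← intervalIntegral.integral_of_le hT.le,
        integral_rpow (Or.inl (by linarith))]
      simp [Real.zero_rpow hα.ne']
  have htail : pnorm p (fun ε => ∫ t in Set.Ioi T, t ^ (α - 1) * noise (Real.exp (-t)) h ε)
      ≤ 2 * T ^ (α - 1) * pnorm p h := by
    refine (pnorm_integral_le hp1 measurableSet_Ioi (fun ε => (hFint ε).mono_set hsub2)
      (G := fun t => T ^ (α - 1) * Real.exp (T / 2) * pnorm p h * Real.exp (-(1 / 2) * t))
      ((integrableOn_exp_mul_Ioi (by norm_num) T).const_mul _)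
      fun t ht => ?_).trans (le_of_eq ?_)
    · have ht' : T < t := ht
      have ht0 : 0 < t := hT.trans ht'
      rw [hnorm t ht0]
      have h1 : pnorm p (noise (Real.exp (-t)) h) ≤ Real.exp (T - t) * pnorm p h := by
        have := pnorm_noise_mul_le hp hTp (Real.exp_nonneg (T - t))
          (Real.exp_le_one_iff.2 (by linarith)) hh
        rwa [← Real.exp_add, show -T + (T - t) = -t by ring] at this
      calc _ ≤ T ^ (α - 1) * Real.exp ((t - T) / 2) * (Real.exp (T - t) * pnorm p h) :=
            mul_le_mul (rpow_sub_one_le_mul_exp hT hαT ht'.le) h1 (pnorm_nonneg _ _)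
              (by positivity)
        _ = T ^ (α - 1) * (Real.exp ((t - T) / 2) * Real.exp (T - t)) * pnorm p h := by ring
        _ = T ^ (α - 1) * (Real.exp (T / 2) * Real.exp (-(1 / 2) * t)) * pnorm p h := by
            rw [← Real.exp_add, ← Real.exp_add]
            ring_nf
        _ = _ := by ring
    · rw [MeasureTheory.integral_const_mul, integral_exp_mul_Ioi (by norm_num)]
      have : Real.exp (T / 2) * Real.exp (-(1 / 2) * T) = 1 := by
        rw [← Real.exp_add]
        ring_nf
        exact Real.exp_zero
      linear_combination (2 * T ^ (α - 1) * pnorm p h) * this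
  have hsm := pnorm_smul hp1 (Real.Gamma α) (deltaPow univ (-α) h)
  rw [abs_of_pos (Real.Gamma_pos_of_pos hα), hsplit] at hsm
  rw [← hsm]
  linarith [pnorm_add_le hp1
    (fun ε => ∫ t in Set.Ioc 0 T, t ^ (α - 1) * noise (Real.exp (-t)) h ε)
    (fun ε => ∫ t in Set.Ioi T, t ^ (α - 1) * noise (Real.exp (-t)) h ε)]

/-- **Lemma 3.2, upper bound** (inequality (3.12) / (3.19)): there is a universal `C > 0`
such that for every `p ∈ [2,∞)` and `α ∈ (0, (5 + log p)/4]`, for every `n` and every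
mean-zero `h : {-1,1}^n → ℝ`,
`‖Δ_{[n]}^{-α} h‖_p ≤ C (log p)^α / (2^α Γ(1+α)) ‖h‖_p`. -/
theorem deltaPow_neg_opNorm_upper :
    ∃ C : ℝ, 0 < C ∧ ∀ p : ℝ, 2 ≤ p → ∀ α : ℝ, 0 < α → α ≤ (5 + Real.log p) / 4 →
      ∀ n : ℕ, ∀ h : (Fin n → Bool) → ℝ, (∑ ε : Fin n → Bool, h ε) = 0 →
      pnorm p (deltaPow (univ : Finset (Fin n)) (-α) h) ≤
        C * (Real.log p) ^ α / ((2 : ℝ) ^ α * Real.Gamma (1 + α)) * pnorm p h := by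
  refine ⟨7 / 2 * Real.exp 6, by positivity, fun p hp α hα hαp n h hh => ?_⟩
  set L := Real.log p with hL
  have hL2 : 1 / 2 ≤ L := by
    have := Real.log_two_gt_d9
    have := Real.log_le_log (by norm_num) hp
    linarith
  set T := L / 2 + 1 with hT
  have hT0 : 0 < T := by linarith
  have hTp : 2 * p * Real.exp (-T) ^ 2 ≤ 1 := by
    have h1 : Real.exp (-T) ^ 2 = p⁻¹ * Real.exp (-2) := by
      rw [← Real.exp_nat_mul, ← Real.exp_log (show 0 < p by linarith), ← Real.exp_neg,
        ← Real.exp_add, ← hL, hT]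
      push_cast
      ring_nf
    have h2 : Real.exp (-2) ≤ 1 / 2 := by
      rw [Real.exp_neg, ← one_div]
      exact one_div_le_one_div_of_le two_pos (by linarith [Real.add_one_le_exp 2])
    rw [h1, mul_assoc, mul_inv_cancel_left₀ (by linarith)]
    linarith
  have key := pnorm_deltaPow_neg_le hp hα hT0 hTp (by linarith) hh
  have hΓ := Real.Gamma_pos_of_pos hα
  have hTα : T ^ α ≤ (L / 2) ^ α * Real.exp 6 := by
    have h1 : T = L / 2 * (1 + 2 / L) := by rw [hT]; field_simp
    rw [h1, Real.mul_rpow (by positivity) (by positivity)]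
    gcongr
    calc (1 + 2 / L) ^ α ≤ Real.exp (2 / L) ^ α := by
          gcongr
          linarith [Real.add_one_le_exp (2 / L)]
      _ = Real.exp (2 / L * α) := by rw [← Real.exp_mul]
      _ ≤ _ := by
          gcongr
          rw [div_mul_eq_mul_div, div_le_iff₀ (by linarith)]
          linarith
  have hbound : T ^ α / α + 2 * T ^ (α - 1) ≤ 7 / 2 * Real.exp 6 * (L / 2) ^ α / α := by
    rw [Real.rpow_sub_one hT0.ne']
    calc T ^ α / α + 2 * (T ^ α / T) = T ^ α / α * (1 + 2 * α / T) := by field_simp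
      _ ≤ T ^ α / α * (7 / 2) := by
          gcongr
          have : 2 * α / T ≤ 5 / 2 := by
            rw [div_le_iff₀ hT0]
            linarith
          linarith
      _ ≤ (L / 2) ^ α * Real.exp 6 / α * (7 / 2) := by gcongr
      _ = _ := by ring
  have hfin := key.trans (mul_le_mul_of_nonneg_right hbound (pnorm_nonneg p h))
  rw [mul_comm, ← le_div_iff₀ hΓ] at hfin
  refine hfin.trans (le_of_eq ?_)
  rw [add_comm 1 α, Real.Gamma_add_one hα.ne', Real.div_rpow (by linarith) (by norm_num)]
  field_simp
end
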